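/- arXiv:1609.08481 — 2 statements merged into one kernel-verified Lean document; each statement's English description precedes it below -/
import Mathlib

section
/- Fix n ≥ 2. Suppose that for every d ≤ n and every y ∈ ℒ_d whose orbit A_d·y has compact closure, the closure of A_d·y contains a stable lattice. Then for every x ∈ ℒ_n, the closure of A·x contains a stable lattice. -/
open scoped BigOperators
open Matrix Topology Filter

noncomputable section

namespace SW

/-! ### Euclidean structure on `Fin n → ℝ` -/

/-- The standard Euclidean inner product on `Fin n → ℝ`. -/
def einner {n : ℕ} (v w : Fin n → ℝ) : ℝ := ∑ i, v i * w i

/-- The Euclidean norm on `Fin n → ℝ`. -/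
def enorm {n : ℕ} (v : Fin n → ℝ) : ℝ := Real.sqrt (∑ i, v i ^ 2)

lemma einner_add_left {n : ℕ} (u v w : Fin n → ℝ) :
    einner (u + v) w = einner u w + einner v w := by
  simp [einner, add_mul, Finset.sum_add_distrib]

lemma einner_neg_left {n : ℕ} (u w : Fin n → ℝ) : einner (-u) w = -einner u w := by
  simp [einner]

lemma einner_smul_left {n : ℕ} (c : ℝ) (u w : Fin n → ℝ) :
    einner (c • u) w = c * einner u w := by
  simp [einner, Finset.mul_sum, mul_assoc]

/-! ### Covolume, rank, lattices, stability -/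

/-- `√(det Gram)` of a finite family of vectors: the covolume of the ℤ-span of the family
(in the span of the family) when the family is linearly independent. -/
def gvol {n r : ℕ} (v : Fin r → (Fin n → ℝ)) : ℝ :=
  Real.sqrt (Matrix.det (Matrix.of fun i j => einner (v i) (v j)))

/-- `c` is the covolume of `Λ` in its real span, as computed from some ℤ-basis of `Λ` which is
linearly independent over `ℝ`. -/
def covolSpec {n : ℕ} (Λ : AddSubgroup (Fin n → ℝ)) (c : ℝ) : Prop :=
  ∃ (r : ℕ) (v : Fin r → (Fin n → ℝ)), LinearIndependent ℝ v ∧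
    Λ = AddSubgroup.closure (Set.range v) ∧ c = gvol v

/-- The covolume of a discrete subgroup `Λ ⊆ ℝⁿ` inside its real span (with `covol ⊥ = 1`). -/
def covol {n : ℕ} (Λ : AddSubgroup (Fin n → ℝ)) : ℝ := sInf {c | covolSpec Λ c}

/-- The rank of a discrete subgroup of `ℝⁿ`: the dimension of its real span. -/
def rk {n : ℕ} (Λ : AddSubgroup (Fin n → ℝ)) : ℕ :=
  Module.finrank ℝ (Submodule.span ℝ (Λ : Set (Fin n → ℝ)))

/-- A lattice in `ℝⁿ`: a discrete subgroup spanning `ℝⁿ` (equivalently, cocompact). -/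
def IsLattice {n : ℕ} (L : AddSubgroup (Fin n → ℝ)) : Prop :=
  DiscreteTopology ↥L ∧ Submodule.span ℝ (L : Set (Fin n → ℝ)) = ⊤

/-- A unimodular lattice: a lattice of covolume one. -/
def IsUnimodularLattice {n : ℕ} (L : AddSubgroup (Fin n → ℝ)) : Prop :=
  IsLattice L ∧ covol L = 1

/-- A stable lattice: a unimodular lattice all of whose subgroups have covolume at least one. -/
def IsStable {n : ℕ} (L : AddSubgroup (Fin n → ℝ)) : Prop :=
  IsUnimodularLattice L ∧ ∀ Λ : AddSubgroup (Fin n → ℝ), Λ ≤ L → 1 ≤ covol Λ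

/-! ### Matrices: the diagonal group `A`, `SL_n(ℤ)`, lattices from matrices -/

/-- The group `A` of positive diagonal matrices of determinant one (as a set of matrices). -/
def Apos (n : ℕ) : Set (Matrix (Fin n) (Fin n) ℝ) :=
  {a | ∃ d : Fin n → ℝ, (∀ i, 0 < d i) ∧ (∏ i, d i) = 1 ∧ a = Matrix.diagonal d}

/-- `SL_n(ℤ)` viewed as a set of real matrices. -/
def Gam (n : ℕ) : Set (Matrix (Fin n) (Fin n) ℝ) :=
  {γ | γ.det = 1 ∧ ∀ i j, ∃ m : ℤ, γ i j = (m : ℝ)}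

/-- The lattice `g·ℤⁿ` associated to a matrix `g`. -/
def latticeOf {n : ℕ} (g : Matrix (Fin n) (Fin n) ℝ) : AddSubgroup (Fin n → ℝ) :=
  AddSubgroup.closure (Set.range fun m : Fin n → ℤ => g.mulVec fun i => (m i : ℝ))

/-- The image `g·L` of a lattice under a matrix. -/
def mapLat {n : ℕ} (g : Matrix (Fin n) (Fin n) ℝ) (L : AddSubgroup (Fin n → ℝ)) :
    AddSubgroup (Fin n → ℝ) :=
  AddSubgroup.map (Matrix.mulVecLin g).toAddMonoidHom L

/-- The full preimage `A·g·Γ` in `SL_n(ℝ)` of the orbit `A·[g] ⊆ ℒ_n`; a point `[h] ∈ ℒ_n`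
lies in the closure of `A·[g]` iff `h ∈ closure (AOrbit g)`. -/
def AOrbit {n : ℕ} (g : Matrix (Fin n) (Fin n) ℝ) : Set (Matrix (Fin n) (Fin n) ℝ) :=
  {p | ∃ a ∈ Apos n, ∃ γ ∈ Gam n, p = a * g * γ}

/-- The orbit `A·[g] ⊆ ℒ_n` is bounded (has compact closure). -/
def HasBoundedAOrbit {n : ℕ} (g : Matrix (Fin n) (Fin n) ℝ) : Prop :=
  ∃ K : Set (Matrix (Fin n) (Fin n) ℝ), IsCompact K ∧
    ∀ a ∈ Apos n, ∃ γ ∈ Gam n, a * g * γ ∈ K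

/-! ### `α`, `Min_δ`, `V_δ`, `dim_δ` -/

/-- `α(x) = min { |Λ|^{1/r(Λ)} : Λ a nonzero subgroup of x }`. -/
def alpha {n : ℕ} (x : AddSubgroup (Fin n → ℝ)) : ℝ :=
  sInf {c | ∃ Λ : AddSubgroup (Fin n → ℝ), Λ ≤ x ∧ Λ ≠ ⊥ ∧ c = covol Λ ^ ((rk Λ : ℝ)⁻¹)}

/-- `α_k(x) = min { |Λ|^{1/k} : Λ a rank-`k` subgroup of x }`. -/
def alphak {n : ℕ} (k : ℕ) (x : AddSubgroup (Fin n → ℝ)) : ℝ :=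
  sInf {c | ∃ Λ : AddSubgroup (Fin n → ℝ), Λ ≤ x ∧ rk Λ = k ∧ c = covol Λ ^ ((k : ℝ)⁻¹)}

/-- `Min_δ(x)`: nonzero subgroups nearly attaining `α(x)`. -/
def MinSet {n : ℕ} (δ : ℝ) (x : AddSubgroup (Fin n → ℝ)) : Set (AddSubgroup (Fin n → ℝ)) :=
  {Λ | Λ ≤ x ∧ Λ ≠ ⊥ ∧ covol Λ ^ ((rk Λ : ℝ)⁻¹) < (1 + δ) * alpha x}

/-- `V_δ(x)`: the span of the subgroups in `Min_δ(x)`. -/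
def Vdelta {n : ℕ} (δ : ℝ) (x : AddSubgroup (Fin n → ℝ)) : Submodule ℝ (Fin n → ℝ) :=
  Submodule.span ℝ (⋃ Λ ∈ MinSet δ x, (Λ : Set (Fin n → ℝ)))

/-- `dim_δ(x) = dim V_δ(x)`. -/
def dimdelta {n : ℕ} (δ : ℝ) (x : AddSubgroup (Fin n → ℝ)) : ℕ :=
  Module.finrank ℝ (Vdelta δ x)

/-- `U_k^{x,ε} ⊆ A`: those `a` for which `δ ↦ dim_δ(ax)` equals `k` near `kε`. -/
def Uset {n : ℕ} (x : AddSubgroup (Fin n → ℝ)) (ε : ℝ) (k : ℕ) :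
    Set (Matrix (Fin n) (Fin n) ℝ) :=
  {a | a ∈ Apos n ∧ ∃ s ∈ 𝓝 ((k : ℝ) * ε), ∀ δ ∈ s, dimdelta δ (mapLat a x) = k}

/-- Logarithmic coordinates on the diagonal group. -/
def logCoord {n : ℕ} (a : Matrix (Fin n) (Fin n) ℝ) : Fin n → ℝ := fun i => Real.log (a i i)

/-! ### Covering radius -/

/-- The covering radius `covrad(L) = sup_u inf_{v ∈ L} ‖u - v‖`. -/
def covrad {n : ℕ} (L : AddSubgroup (Fin n → ℝ)) : ℝ :=
  ⨆ u : Fin n → ℝ, ⨅ v : L, enorm (u - (v : Fin n → ℝ))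

/-- `[g]` is a local maximum of `covrad : ℒ_d → ℝ` (phrased via the open quotient
`SL_d(ℝ) → ℒ_d`). -/
def IsLocalMaxCovrad {d : ℕ} (g : Matrix (Fin d) (Fin d) ℝ) : Prop :=
  ∃ W ∈ 𝓝 g, ∀ g' ∈ W, Matrix.det g' = 1 → covrad (latticeOf g') ≤ covrad (latticeOf g)

/-! ### Block upper triangular form -/

/-- Offset of the `i`-th diagonal block. -/
def off {k : ℕ} (ns : Fin k → ℕ) (i : Fin k) : ℕ :=
  ∑ j ∈ Finset.univ.filter (fun j => j < i), ns j

lemma off_add_lt {k : ℕ} (ns : Fin k → ℕ) (i : Fin k) (a : Fin (ns i)) :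
    off ns i + (a : ℕ) < ∑ j, ns j := by
  unfold off
  have hins : i ∉ Finset.univ.filter (fun j => j < i) := by simp
  have h2 : ∑ j ∈ insert i (Finset.univ.filter (fun j => j < i)), ns j ≤ ∑ j, ns j :=
    Finset.sum_le_sum_of_subset (Finset.subset_univ _)
  rw [Finset.sum_insert hins] at h2
  have := a.isLt
  omega

/-- The position, in `Fin n`, of the `a`-th coordinate of the `i`-th block. -/
def blockEmb {n k : ℕ} (ns : Fin k → ℕ) (hsum : (∑ j, ns j) = n) (i : Fin k)
    (a : Fin (ns i)) : Fin n :=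
  ⟨off ns i + (a : ℕ), hsum ▸ off_add_lt ns i a⟩

/-- `g` is block upper triangular with diagonal blocks `G i` (block sizes `ns`). -/
def IsBlockUT {n k : ℕ} (ns : Fin k → ℕ) (hsum : (∑ j, ns j) = n)
    (g : Matrix (Fin n) (Fin n) ℝ) (G : ∀ i, Matrix (Fin (ns i)) (Fin (ns i)) ℝ) : Prop :=
  (∀ (i : Fin k) (a b : Fin (ns i)),
      g (blockEmb ns hsum i a) (blockEmb ns hsum i b) = G i a b) ∧
  (∀ (i j : Fin k) (a : Fin (ns i)) (b : Fin (ns j)), j < i →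
      g (blockEmb ns hsum i a) (blockEmb ns hsum j b) = 0)

/-! ### Mordell constant -/

/-- The symmetric box `[-a₁,a₁] × ⋯ × [-aₙ,aₙ]` is admissible for `L`: its interior contains
no nonzero point of `L`. -/
def IsAdmissibleBox {n : ℕ} (L : AddSubgroup (Fin n → ℝ)) (a : Fin n → ℝ) : Prop :=
  (∀ i, 0 < a i) ∧ ∀ v ∈ L, v ≠ 0 → ∃ i, a i ≤ |v i|

/-- The Mordell constant `κ(L) = 2⁻ⁿ sup { Vol(B) : B admissible symmetric box for L }`. -/
def mordellConst {n : ℕ} (L : AddSubgroup (Fin n → ℝ)) : ℝ :=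
  (1 / 2 ^ n) * sSup {V | ∃ a : Fin n → ℝ, IsAdmissibleBox L a ∧ V = ∏ i, 2 * a i}

/-! ### Hermite constant -/

/-- Length of a shortest nonzero vector of `L`. -/
def shortest {m : ℕ} (L : AddSubgroup (Fin m → ℝ)) : ℝ :=
  sInf {t | ∃ w ∈ L, w ≠ 0 ∧ t = enorm w}

/-- The Hermite constant `γ_m`. -/
def hermiteConst (m : ℕ) : ℝ :=
  sSup {c | ∃ L : AddSubgroup (Fin m → ℝ), IsUnimodularLattice L ∧ c = shortest L ^ 2}

/-! ### Korkine–Zolotarev reduction -/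

/-- `v 0, …, v (n-1)` is a Korkine–Zolotarev reduced basis of `x`: it is a ℤ-basis, and for
each `i` the orthogonal projection of `v i` onto `span(v 0, …, v (i-1))^⊥` is shortest among the
nonzero such projections of vectors of `x` (projection lengths are expressed through Gram
determinants: the projection of `w` has length `gvol (v 0, …, v (i-1), w) / gvol (v 0, …, v (i-1))`). -/
def IsKZBasis {n : ℕ} (x : AddSubgroup (Fin n → ℝ)) (v : ℕ → (Fin n → ℝ)) : Prop :=
  LinearIndependent ℝ (fun j : Fin n => v (j : ℕ)) ∧
  x = AddSubgroup.closure (v '' Set.Iio n) ∧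
  ∀ i < n, ∀ w ∈ x, w ∉ Submodule.span ℝ (v '' Set.Iio i) →
    gvol (Fin.snoc (fun j : Fin i => v (j : ℕ)) (v i)) ≤
      gvol (Fin.snoc (fun j : Fin i => v (j : ℕ)) w)

/-- `A 0, …, A (n-1)` are the diagonal Korkine–Zolotarev coefficients of `x`: the lengths of
the successive orthogonal projections in a KZ reduced basis, i.e.
`A i = gvol (v 0, …, v i) / gvol (v 0, …, v (i-1))`. -/
def HasKZCoeffs {n : ℕ} (x : AddSubgroup (Fin n → ℝ)) (A : ℕ → ℝ) : Prop :=
  ∃ v : ℕ → (Fin n → ℝ), IsKZBasis x v ∧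
    ∀ i < n, A i * gvol (fun j : Fin i => v (j : ℕ)) = gvol (fun j : Fin (i + 1) => v (j : ℕ))

/-! ### Orthogonal complements and projections of lattices -/

/-- The orthogonal complement of a subspace `V ⊆ ℝⁿ`. -/
def orthoC {n : ℕ} (V : Submodule ℝ (Fin n → ℝ)) : Submodule ℝ (Fin n → ℝ) where
  carrier := {w | ∀ v ∈ V, einner w v = 0}
  zero_mem' := by intro v hv; simp [einner]
  add_mem' := by intro a b ha hb v hv; rw [einner_add_left, ha v hv, hb v hv, add_zero]
  smul_mem' := by intro c w hw v hv; rw [einner_smul_left, hw v hv, mul_zero]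

/-- The image `π(x)` of `x` under the orthogonal projection `π : ℝⁿ → V^⊥`:
`p = π(u)` iff `p ⊥ V` and `u - p ∈ V`. -/
def projLat {n : ℕ} (V : Submodule ℝ (Fin n → ℝ)) (x : AddSubgroup (Fin n → ℝ)) :
    AddSubgroup (Fin n → ℝ) where
  carrier := {p | (∀ v ∈ V, einner p v = 0) ∧ ∃ u ∈ x, u - p ∈ V}
  zero_mem' := ⟨by intro v hv; simp [einner], 0, x.zero_mem, by rw [sub_zero]; exact V.zero_mem⟩
  add_mem' := by
    rintro p q ⟨hp1, u1, hu1, hp2⟩ ⟨hq1, u2, hu2, hq2⟩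
    refine ⟨fun v hv => by rw [einner_add_left, hp1 v hv, hq1 v hv, add_zero],
      u1 + u2, x.add_mem hu1 hu2, ?_⟩
    have h : u1 + u2 - (p + q) = u1 - p + (u2 - q) := by abel
    rw [h]; exact V.add_mem hp2 hq2
  neg_mem' := by
    rintro p ⟨hp1, u, hu, hp2⟩
    refine ⟨fun v hv => by rw [einner_neg_left, hp1 v hv, neg_zero],
      -u, x.neg_mem hu, ?_⟩
    have h : -u - -p = -(u - p) := by abel
    rw [h]; exact V.neg_mem hp2

end SW


namespace SW

/-! ### Gram determinants -/

lemma det_le_det_add_vecMulVec {τ : Type*} [Fintype τ] [DecidableEq τ] {A : Matrix τ τ ℝ}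
    (hA : A.PosDef) (v : τ → ℝ) : A.det ≤ (A + vecMulVec v v).det := by
  have h : vecMulVec v v = replicateCol Unit v * replicateRow Unit v := by
    ext i j; simp [vecMulVec_apply, Matrix.mul_apply]
  rw [h, det_add_replicateCol_mul_replicateRow hA.det_pos.ne'.isUnit]
  have h1 : 0 ≤ v ⬝ᵥ (A⁻¹ *ᵥ v) := by
    simpa using hA.inv.posSemidef.dotProduct_mulVec_nonneg v
  have h2 : (1 + replicateRow Unit v * A⁻¹ * replicateCol Unit v).det
      = 1 + v ⬝ᵥ (A⁻¹ *ᵥ v) := by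
    rw [det_unique, Matrix.mul_assoc]
    simp [Matrix.add_apply, Matrix.mul_apply, dotProduct, mulVec]
  rw [h2]
  nlinarith [hA.det_pos]

lemma posDef_and_det_le_det_add_sum {τ κ : Type*} [Fintype τ] [DecidableEq τ]
    {A : Matrix τ τ ℝ} (hA : A.PosDef) (V : κ → τ → ℝ) (s : Finset κ) :
    (A + ∑ k ∈ s, vecMulVec (V k) (V k)).PosDef ∧
      A.det ≤ (A + ∑ k ∈ s, vecMulVec (V k) (V k)).det := by
  classical
  induction s using Finset.induction_on with
  | empty => simpa using hA
  | insert k s hk ih =>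
    rw [Finset.sum_insert hk, add_comm (vecMulVec _ _), ← add_assoc]
    refine ⟨ih.1.add_posSemidef ?_, ih.2.trans (det_le_det_add_vecMulVec ih.1 _)⟩
    simpa using posSemidef_vecMulVec_self_star (V k)

lemma det_le_det_add_transpose_mul {τ κ : Type*} [Fintype τ] [DecidableEq τ] [Fintype κ]
    {A : Matrix τ τ ℝ} (hA : A.PosDef) (V : Matrix κ τ ℝ) : A.det ≤ (A + Vᵀ * V).det := by
  have h : Vᵀ * V = ∑ k, vecMulVec (V k) (V k) := by
    ext i j; simp [Matrix.mul_apply, Matrix.sum_apply, vecMulVec_apply]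
  rw [h]
  exact (posDef_and_det_le_det_add_sum hA _ _).2

lemma posDef_gram {ι τ : Type*} [Fintype ι] [Fintype τ] [DecidableEq τ] {P : Matrix ι τ ℝ}
    (hP : (Pᵀ * P).det ≠ 0) : (Pᵀ * P).PosDef :=
  (by simpa using posSemidef_conjTranspose_mul_self P :
    (Pᵀ * P).PosSemidef).posDef_iff_det_ne_zero.2 hP

/-- The Gram determinant of a block upper triangular matrix is at least the product of those of
its diagonal blocks. -/
lemma det_gram_mul_det_gram_le {ι κ α β : Type*} [Fintype ι] [Fintype κ] [Fintype α] [Fintype β]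
    [DecidableEq ι] [DecidableEq α] [DecidableEq β] (P : Matrix ι α ℝ) (Q : Matrix ι β ℝ)
    (S : Matrix κ β ℝ) (hP : (Pᵀ * P).det ≠ 0) (hS : (Sᵀ * S).det ≠ 0) :
    (Pᵀ * P).det * (Sᵀ * S).det ≤
      ((fromBlocks P Q 0 S)ᵀ * fromBlocks P Q 0 S).det := by
  have hPd := posDef_gram hP
  have hSd := posDef_gram hS
  let _ : Invertible (Pᵀ * P) := invertibleOfIsUnitDet _ hP.isUnit
  rw [fromBlocks_transpose, fromBlocks_multiply, transpose_zero]
  simp only [Matrix.zero_mul, Matrix.mul_zero, add_zero]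
  rw [det_fromBlocks₁₁, invOf_eq_nonsing_inv]
  refine mul_le_mul_of_nonneg_left ?_ hPd.det_pos.le
  set R : Matrix ι ι ℝ := 1 - P * (Pᵀ * P)⁻¹ * Pᵀ with hR
  have hRt : Rᵀ = R := by
    simp [hR, transpose_mul, transpose_nonsing_inv, Matrix.mul_assoc]
  have hRR : R * R = R := by
    have h1 : P * (Pᵀ * P)⁻¹ * Pᵀ * (P * (Pᵀ * P)⁻¹ * Pᵀ) = P * (Pᵀ * P)⁻¹ * Pᵀ := by
      calc P * (Pᵀ * P)⁻¹ * Pᵀ * (P * (Pᵀ * P)⁻¹ * Pᵀ)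
          = P * ((Pᵀ * P)⁻¹ * (Pᵀ * P)) * (Pᵀ * P)⁻¹ * Pᵀ := by simp only [Matrix.mul_assoc]
        _ = _ := by rw [nonsing_inv_mul _ hP.isUnit, Matrix.mul_one]
    rw [hR, Matrix.sub_mul, Matrix.one_mul, Matrix.mul_sub, Matrix.mul_one, h1, sub_self, sub_zero]
  have key : Qᵀ * Q + Sᵀ * S - Qᵀ * P * (Pᵀ * P)⁻¹ * (Pᵀ * Q)
      = Sᵀ * S + (R * Q)ᵀ * (R * Q) := by
    have : (R * Q)ᵀ * (R * Q) = Qᵀ * (R * R) * Q := by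
      rw [transpose_mul, hRt]; simp only [Matrix.mul_assoc]
    rw [this, hRR, hR, Matrix.mul_sub, Matrix.mul_one, Matrix.sub_mul]
    simp only [Matrix.mul_assoc]
    abel
  rw [key]
  exact det_le_det_add_transpose_mul hSd _

/-! ### Matrix form of stability -/

/-- A real matrix obtained by casting an integer matrix. -/
abbrev castM {ι κ : Type*} (m : Matrix ι κ ℤ) : Matrix ι κ ℝ := m.map (fun z : ℤ => (z : ℝ))

lemma castM_mul {ι κ τ : Type*} [Fintype κ] (m : Matrix ι κ ℤ) (k : Matrix κ τ ℤ) :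
    castM (m * k) = castM m * castM k := by
  ext i j; simp [Matrix.mul_apply]

lemma det_castM {ι : Type*} [Fintype ι] [DecidableEq ι] (m : Matrix ι ι ℤ) :
    (castM m).det = (m.det : ℝ) :=
  (Int.cast_det m).symm

/-- The columns of an integer matrix are linearly independent over `ℤ`. -/
def ColInj {ι κ : Type*} [Fintype κ] (m : Matrix ι κ ℤ) : Prop :=
  ∀ v : κ → ℤ, m *ᵥ v = 0 → v = 0

/-- Matrix form of stability of the lattice spanned by the columns of `g`. -/
def MStable {ι : Type*} [Fintype ι] [DecidableEq ι] (g : Matrix ι ι ℝ) : Prop :=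
  ∀ (r : ℕ) (m : Matrix ι (Fin r) ℤ), ColInj m → 1 ≤ ((g * castM m)ᵀ * (g * castM m)).det

lemma ColInj.castM_mulVec_eq_zero {ι κ : Type*} [Fintype ι] [Fintype κ] [DecidableEq κ]
    {m : Matrix ι κ ℤ} (hm : ColInj m) {v : κ → ℝ} (hv : castM m *ᵥ v = 0) : v = 0 := by
  have h1 : (mᵀ * m).det ≠ 0 := by
    intro h0
    obtain ⟨w, hw, hw0⟩ := exists_mulVec_eq_zero_iff.2 h0
    apply hw
    apply hm
    have : (m *ᵥ w) ⬝ᵥ (m *ᵥ w) = 0 := by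
      rw [dotProduct_mulVec, vecMul_mulVec, ← dotProduct_mulVec, hw0, dotProduct_zero]
    exact dotProduct_self_eq_zero.1 this
  have h2 : ((castM m)ᵀ * castM m).det ≠ 0 := by
    have : (castM m)ᵀ * castM m = castM (mᵀ * m) := by rw [castM_mul]; rfl
    rw [this, det_castM]
    exact_mod_cast h1
  by_contra hne
  exact h2 (exists_mulVec_eq_zero_iff.1 ⟨v, hne, by rw [← mulVec_mulVec, hv, mulVec_zero]⟩)

lemma MStable.submatrix {ι ι' : Type*} [Fintype ι] [DecidableEq ι] [Fintype ι'] [DecidableEq ι']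
    {g : Matrix ι ι ℝ} (hg : MStable g) (σ e : ι' ≃ ι) : MStable (g.submatrix σ e) := by
  intro r m hm
  have h1 : ColInj (m.submatrix e.symm id) := by
    intro v hv
    apply hm
    ext i
    simpa [mulVec, dotProduct] using congrFun hv (e i)
  have h2 : g.submatrix σ e * castM m = (g * castM (m.submatrix e.symm id)).submatrix σ id := by
    ext i j
    simp only [Matrix.mul_apply, submatrix_apply, map_apply]
    rw [← e.sum_comp]
    simp
  have h3 := hg r _ h1
  rw [h2, transpose_submatrix, submatrix_mul_equiv]
  simpa using h3

lemma MStable.mul_castM {ι : Type*} [Fintype ι] [DecidableEq ι]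
    {g : Matrix ι ι ℝ} (hg : MStable g) {γ : Matrix ι ι ℤ} (hγ : IsUnit γ.det) :
    MStable (g * castM γ) := by
  intro r m hm
  rw [Matrix.mul_assoc, ← castM_mul]
  refine hg r _ fun v hv => hm v ?_
  rw [← mulVec_mulVec] at hv
  by_contra hne
  exact hγ.ne_zero (exists_mulVec_eq_zero_iff.1 ⟨_, hne, hv⟩)

/-- A basis of `ℤ^r` adapted to the kernel of an integer matrix, as a unimodular matrix. -/
lemma exists_adapted_basis {κ : Type*} [Fintype κ] [DecidableEq κ] {r : ℕ}
    (m : Matrix κ (Fin r) ℤ) :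
    ∃ (r₁ r₂ : ℕ) (e : Fin r₁ ⊕ Fin r₂ ≃ Fin r) (β : Matrix (Fin r) (Fin r₁ ⊕ Fin r₂) ℤ),
      IsUnit (β.submatrix id e.symm).det ∧ (∀ i j, (m * β) i (Sum.inl j) = 0) ∧
      ColInj (of fun i j => (m * β) i (Sum.inr j)) := by
  set f := m.mulVecLin with hf
  obtain ⟨r₁, b₁⟩ := Submodule.basisOfPid (Pi.basisFun ℤ (Fin r)) (LinearMap.ker f)
  obtain ⟨r₂, b₂⟩ := Submodule.basisOfPid (Pi.basisFun ℤ κ) (LinearMap.range f)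
  let b := Module.Basis.sumQuot b₁ (b₂.map f.quotKerEquivRange.symm)
  have hcard : Nonempty (Fin r₁ ⊕ Fin r₂ ≃ Fin r) :=
    ⟨b.indexEquiv (Pi.basisFun ℤ (Fin r))⟩
  obtain ⟨e⟩ := hcard
  have hmul : ∀ i j, (m * of fun i j => b j i) i j = f (b j) i := by
    intro i j; simp [Matrix.mul_apply, hf, mulVec, dotProduct]
  refine ⟨r₁, r₂, e, of fun i j => b j i, ?_, ?_, ?_⟩
  · have := (Pi.basisFun ℤ (Fin r)).isUnit_det (b.reindex e)
    rw [Module.Basis.det_apply] at this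
    have h : (of fun i j => b j i).submatrix id e.symm
        = (Pi.basisFun ℤ (Fin r)).toMatrix (b.reindex e) := by
      ext i j
      simp [Module.Basis.toMatrix_apply]
    rwa [h]
  · intro i j
    rw [hmul]
    have : f (b (Sum.inl j)) = 0 := by
      simp only [b, Module.Basis.sumQuot_inl]
      exact (b₁ j).2
    simp [this]
  · intro v hv
    have hb : ∀ j, f (b (Sum.inr j)) = b₂ j := by
      intro j
      have h := Module.Basis.sumQuot_inr b₁ (b₂.map f.quotKerEquivRange.symm) j
      have h' := congrArg f.quotKerEquivRange h
      rw [Module.Basis.map_apply, LinearEquiv.apply_symm_apply] at h'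
      rw [← h']
      rfl
    have hsum : ∑ j, v j • b₂ j = 0 := by
      ext i
      have h := congrFun hv i
      simp only [mulVec, dotProduct, of_apply, hmul, hb, Pi.zero_apply] at h
      simp only [Submodule.coe_sum, Submodule.coe_smul, Finset.sum_apply, Pi.smul_apply,
        smul_eq_mul, ZeroMemClass.coe_zero, Pi.zero_apply]
      rw [← h]
      exact Finset.sum_congr rfl fun j _ => mul_comm _ _
    ext j
    exact Fintype.linearIndependent_iff.1 b₂.linearIndependent v hsum j

lemma MStable.fromBlocks {ι κ : Type*} [Fintype ι] [DecidableEq ι] [Fintype κ] [DecidableEq κ]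
    {B : Matrix ι ι ℝ} {C : Matrix κ κ ℝ} (hB : MStable B) (hC : MStable C) (Y : Matrix ι κ ℝ) :
    MStable (fromBlocks B Y 0 C) := by
  intro r m hm
  obtain ⟨r₁, r₂, e, β, hβ, h0, hinj⟩ := exists_adapted_basis (m.submatrix Sum.inr id)
  have h0' : ∀ i j, (m * β) (Sum.inr i) (Sum.inl j) = 0 := h0
  set p : Matrix ι (Fin r₁) ℤ := of fun i j => (m * β) (Sum.inl i) (Sum.inl j) with hp
  set q : Matrix ι (Fin r₂) ℤ := of fun i j => (m * β) (Sum.inl i) (Sum.inr j) with hq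
  set s : Matrix κ (Fin r₂) ℤ := of fun i j => (m * β) (Sum.inr i) (Sum.inr j) with hs
  have hmβ : m * β = Matrix.fromBlocks p q 0 s := by
    ext (i | i) (j | j)
    · rfl
    · rfl
    · exact h0' i j
    · rfl
  have hpinj : ColInj p := by
    intro v hv
    have h1 : (m * β) *ᵥ Sum.elim v 0 = 0 := by
      rw [hmβ, fromBlocks_mulVec]; ext (i | i) <;> simp [hv]
    have h2 : β *ᵥ Sum.elim v 0 = 0 := hm _ (by rw [mulVec_mulVec, h1])
    have h3 : (β.submatrix id e.symm) *ᵥ (Sum.elim v 0 ∘ e.symm) = 0 := by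
      rw [submatrix_mulVec_equiv]
      ext i
      simpa [Function.comp_assoc] using congrFun h2 i
    have h4 : Sum.elim v 0 ∘ e.symm = 0 := by
      by_contra hne
      exact hβ.ne_zero (exists_mulVec_eq_zero_iff.1 ⟨_, hne, h3⟩)
    ext j
    simpa using congrFun h4 (e (Sum.inl j))
  set G := Matrix.fromBlocks B Y 0 C * castM m with hG
  have hGβ : G * castM β = Matrix.fromBlocks (B * castM p) (B * castM q + Y * castM s) 0
      (C * castM s) := by
    rw [hG, Matrix.mul_assoc, ← castM_mul, hmβ]
    have : castM (Matrix.fromBlocks p q 0 s)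
        = Matrix.fromBlocks (castM p) (castM q) 0 (castM s) := by
      simp [castM, fromBlocks_map]
    rw [this, fromBlocks_multiply]
    simp
  have hB1 := hB _ p hpinj
  have hC1 := hC _ s hinj
  have hle := det_gram_mul_det_gram_le (B * castM p) (B * castM q + Y * castM s) (C * castM s)
    (by positivity) (by positivity)
  have hdet : ((G * castM β)ᵀ * (G * castM β)).det = (Gᵀ * G).det := by
    have hu : (castM (β.submatrix id e.symm)).det ^ 2 = 1 := by
      rw [det_castM]
      rcases Int.isUnit_iff.1 hβ with h | h <;> simp [h]
    have h1 : ((G * castM β)ᵀ * (G * castM β)).det =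
        (((G * castM β)ᵀ * (G * castM β)).submatrix e.symm e.symm).det :=
      (det_submatrix_equiv_self _ _).symm
    have h2 : ((G * castM β)ᵀ * (G * castM β)).submatrix e.symm e.symm =
        (castM (β.submatrix id e.symm))ᵀ * ((Gᵀ * G) * castM (β.submatrix id e.symm)) := by
      rw [transpose_mul]
      simp only [Matrix.mul_assoc]
      rfl
    rw [h1, h2, det_mul, det_mul, det_transpose]
    linear_combination (Gᵀ * G).det * hu
  rw [← hdet, hGβ]
  nlinarith [mul_le_mul hB1 hC1 zero_le_one (zero_le_one.trans hB1)]

end SW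

namespace SW

/-! ### Comparison of the two forms of stability -/

lemma mem_latticeOf {n : ℕ} {g : Matrix (Fin n) (Fin n) ℝ} {w : Fin n → ℝ} :
    w ∈ latticeOf g ↔ ∃ m : Fin n → ℤ, w = g *ᵥ fun i => (m i : ℝ) := by
  constructor
  · intro hw
    induction hw using AddSubgroup.closure_induction with
    | mem x hx => obtain ⟨m, rfl⟩ := hx; exact ⟨m, rfl⟩
    | zero => exact ⟨0, by simp [← Pi.zero_def]⟩
    | add x y _ _ hx hy =>
      obtain ⟨a, rfl⟩ := hx
      obtain ⟨b, rfl⟩ := hy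
      refine ⟨a + b, ?_⟩
      rw [← mulVec_add]
      congr 1; ext i; simp
    | neg x _ hx =>
      obtain ⟨a, rfl⟩ := hx
      refine ⟨-a, ?_⟩
      rw [← mulVec_neg]
      congr 1; ext i; simp
  · rintro ⟨m, rfl⟩
    exact AddSubgroup.subset_closure ⟨m, rfl⟩

lemma mulVec_intCast_eq_sum {n : ℕ} (g : Matrix (Fin n) (Fin n) ℝ) (k : Fin n → ℤ) :
    (g *ᵥ fun i => (k i : ℝ))
      = ∑ j, k j • (g *ᵥ fun i => ((1 : Matrix (Fin n) (Fin n) ℤ) i j : ℝ)) := by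
  simp only [← Int.cast_smul_eq_zsmul ℝ, ← mulVec_smul]
  rw [← mulVec_sum]
  congr 1
  ext i
  simp [Finset.sum_apply, Matrix.one_apply]

lemma gvol_eq_sqrt_det {n r : ℕ} (g : Matrix (Fin n) (Fin n) ℝ) (m : Matrix (Fin n) (Fin r) ℤ) :
    gvol (fun j => g *ᵥ fun i => (m i j : ℝ)) =
      Real.sqrt ((g * castM m)ᵀ * (g * castM m)).det := by
  unfold gvol einner
  congr 1

lemma linearIndependent_mulVec_iff {n r : ℕ} {g : Matrix (Fin n) (Fin n) ℝ} (hg : g.det ≠ 0)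
    (m : Matrix (Fin n) (Fin r) ℤ) :
    LinearIndependent ℝ (fun j => g *ᵥ fun i => (m i j : ℝ)) ↔ ColInj m := by
  have hsum : ∀ c : Fin r → ℝ, ∑ j, c j • (g *ᵥ fun i => (m i j : ℝ)) = g *ᵥ (castM m *ᵥ c) := by
    intro c
    simp only [← mulVec_smul]
    rw [← mulVec_sum]
    congr 1
    ext i
    simp [mulVec, dotProduct, Finset.sum_apply, mul_comm]
  rw [Fintype.linearIndependent_iff]
  constructor
  · intro h v hv
    have h1 := h (fun j => (v j : ℝ)) <| by
      rw [hsum]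
      have : castM m *ᵥ (fun j => (v j : ℝ)) = 0 := by
        ext i
        have := congrFun hv i
        simp only [mulVec, dotProduct, Pi.zero_apply] at this
        simp only [mulVec, dotProduct, map_apply, Pi.zero_apply]
        exact_mod_cast this
      rw [this, mulVec_zero]
    ext j
    exact_mod_cast h1 j
  · intro hm c hc
    rw [hsum] at hc
    have h1 : castM m *ᵥ c = 0 := by
      by_contra hne
      exact hg (exists_mulVec_eq_zero_iff.1 ⟨_, hne, hc⟩)
    exact congrFun (hm.castM_mulVec_eq_zero h1)

lemma bddBelow_covolSpec {n : ℕ} (Λ : AddSubgroup (Fin n → ℝ)) : BddBelow {c | covolSpec Λ c} := by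
  refine ⟨0, ?_⟩
  rintro c ⟨r, v, -, -, rfl⟩
  exact Real.sqrt_nonneg _

lemma IsStable.mStable {n : ℕ} {g : Matrix (Fin n) (Fin n) ℝ} (hg : g.det ≠ 0)
    (h : IsStable (latticeOf g)) : MStable g := by
  intro r m hm
  set v : Fin r → Fin n → ℝ := fun j => g *ᵥ fun i => (m i j : ℝ) with hv
  have hle : AddSubgroup.closure (Set.range v) ≤ latticeOf g := by
    rw [AddSubgroup.closure_le]
    rintro _ ⟨j, rfl⟩
    exact mem_latticeOf.2 ⟨fun i => m i j, rfl⟩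
  have h1 : covol (AddSubgroup.closure (Set.range v)) ≤ gvol v :=
    csInf_le (bddBelow_covolSpec _) ⟨r, v, (linearIndependent_mulVec_iff hg m).2 hm, rfl, rfl⟩
  have h2 := (h.2 _ hle).trans h1
  rw [hv, gvol_eq_sqrt_det, Real.one_le_sqrt] at h2
  exact h2

lemma MStable.one_le_of_covolSpec {n : ℕ} {g : Matrix (Fin n) (Fin n) ℝ} (hg : g.det ≠ 0)
    (h : MStable g) {Λ : AddSubgroup (Fin n → ℝ)} (hΛ : Λ ≤ latticeOf g) {c : ℝ}
    (hc : covolSpec Λ c) : 1 ≤ c := by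
  obtain ⟨r, v, hv, rfl, rfl⟩ := hc
  have hmem : ∀ j, ∃ m : Fin n → ℤ, v j = g *ᵥ fun i => (m i : ℝ) := fun j =>
    mem_latticeOf.1 (hΛ (AddSubgroup.subset_closure ⟨j, rfl⟩))
  choose m hm using hmem
  obtain rfl : v = fun j => g *ᵥ fun i => (((of fun i j => m j i) i j : ℤ) : ℝ) := funext hm
  rw [gvol_eq_sqrt_det, Real.one_le_sqrt]
  exact h r _ ((linearIndependent_mulVec_iff hg _).1 hv)

lemma exists_covolSpec {n : ℕ} {g : Matrix (Fin n) (Fin n) ℝ} (hg : g.det ≠ 0)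
    {Λ : AddSubgroup (Fin n → ℝ)} (hΛ : Λ ≤ latticeOf g) : ∃ c, covolSpec Λ c := by
  let φ : (Fin n → ℤ) →+ (Fin n → ℝ) :=
    { toFun := fun m => g *ᵥ fun i => (m i : ℝ)
      map_zero' := by simp [← Pi.zero_def]
      map_add' := fun a b => by
        rw [← mulVec_add]
        congr 1; ext i; simp }
  let N : Submodule ℤ (Fin n → ℤ) := AddSubgroup.toIntSubmodule (Λ.comap φ)
  obtain ⟨r, b⟩ := Submodule.basisOfPid (Pi.basisFun ℤ (Fin n)) N
  let m : Matrix (Fin n) (Fin r) ℤ := of fun i j => (b j : Fin n → ℤ) i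
  have hm : ColInj m := by
    intro v hv
    have : ∑ j, v j • b j = 0 := by
      ext i
      have h := congrFun hv i
      simp only [m, mulVec, dotProduct, of_apply, Pi.zero_apply] at h
      simp only [Submodule.coe_sum, Submodule.coe_smul, Finset.sum_apply, Pi.smul_apply,
        smul_eq_mul, ZeroMemClass.coe_zero, Pi.zero_apply]
      rw [← h]
      exact Finset.sum_congr rfl fun j _ => mul_comm _ _
    ext j
    exact Fintype.linearIndependent_iff.1 b.linearIndependent v this j
  refine ⟨_, r, fun j => g *ᵥ fun i => (m i j : ℝ), (linearIndependent_mulVec_iff hg m).2 hm,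
    le_antisymm ?_ ?_, rfl⟩
  · intro w hw
    obtain ⟨k, rfl⟩ := mem_latticeOf.1 (hΛ hw)
    have hk : k ∈ N := hw
    have hrep : ((∑ j, b.repr ⟨k, hk⟩ j • b j : N) : Fin n → ℤ) = k :=
      congrArg (fun y : N => (y : Fin n → ℤ)) (b.sum_repr ⟨k, hk⟩)
    have : (g *ᵥ fun i => (k i : ℝ)) = ∑ j, b.repr ⟨k, hk⟩ j • φ (b j) := by
      have h := congrArg φ hrep
      rw [Submodule.coe_sum, map_sum] at h
      refine h.symm.trans (Finset.sum_congr rfl fun j _ => ?_)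
      rw [Submodule.coe_smul, map_zsmul]
    rw [this]
    exact sum_mem fun j _ => AddSubgroup.zsmul_mem _
      (AddSubgroup.subset_closure (Set.mem_range_self j)) _
  · rw [AddSubgroup.closure_le]
    rintro _ ⟨j, rfl⟩
    exact (b j).2

lemma isLattice_latticeOf {n : ℕ} {g : Matrix (Fin n) (Fin n) ℝ} (hg : g.det ≠ 0) :
    IsLattice (latticeOf g) := by
  have hli : LinearIndependent ℝ (fun j => g *ᵥ fun i => ((1 : Matrix (Fin n) (Fin n) ℤ) i j : ℝ)) :=
    (linearIndependent_mulVec_iff hg 1).2 fun v hv => by simpa using hv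
  have hspan := hli.span_eq_top_of_card_eq_finrank' (by simp)
  let b := Module.Basis.mk hli hspan.ge
  have hmem : ∀ j, b j ∈ latticeOf g := fun j => by
    rw [Module.Basis.mk_apply]
    exact mem_latticeOf.2 ⟨_, rfl⟩
  constructor
  · have : latticeOf g ≤ (Submodule.span ℤ (Set.range b)).toAddSubgroup := by
      intro w hw
      obtain ⟨k, rfl⟩ := mem_latticeOf.1 hw
      have : (g *ᵥ fun i => (k i : ℝ)) = ∑ j, k j • b j := by
        simp only [b, Module.Basis.mk_apply, mulVec_intCast_eq_sum g k]
      rw [this]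
      exact sum_mem fun j _ => Submodule.smul_mem _ _ (Submodule.subset_span ⟨j, rfl⟩)
    have hd : DiscreteTopology (Submodule.span ℤ (Set.range b)) := inferInstance
    exact DiscreteTopology.of_subset (t := (latticeOf g : Set (Fin n → ℝ))) hd this
  · rw [eq_top_iff, ← b.span_eq]
    exact Submodule.span_mono (by rintro _ ⟨j, rfl⟩; exact hmem j)

lemma MStable.isStable {n : ℕ} {g : Matrix (Fin n) (Fin n) ℝ} (hg : |g.det| = 1)
    (h : MStable g) : IsStable (latticeOf g) := by
  have hg0 : g.det ≠ 0 := by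
    intro h0; simp [h0] at hg
  have hone : ∀ Λ : AddSubgroup (Fin n → ℝ), Λ ≤ latticeOf g → 1 ≤ covol Λ := fun Λ hΛ =>
    le_csInf (exists_covolSpec hg0 hΛ) fun c hc => h.one_le_of_covolSpec hg0 hΛ hc
  refine ⟨⟨isLattice_latticeOf hg0, le_antisymm ?_ (hone _ le_rfl)⟩, hone⟩
  refine csInf_le (bddBelow_covolSpec _)
    ⟨n, fun j => g *ᵥ fun i => ((1 : Matrix (Fin n) (Fin n) ℤ) i j : ℝ),
      (linearIndependent_mulVec_iff hg0 1).2 fun v hv => by simpa using hv, le_antisymm ?_ ?_, ?_⟩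
  · intro w hw
    obtain ⟨k, rfl⟩ := mem_latticeOf.1 hw
    rw [mulVec_intCast_eq_sum]
    exact sum_mem fun j _ => AddSubgroup.zsmul_mem _
      (AddSubgroup.subset_closure (Set.mem_range_self j)) _
  · rw [AddSubgroup.closure_le]
    rintro _ ⟨j, rfl⟩
    exact mem_latticeOf.2 ⟨_, rfl⟩
  · have h1 : castM (1 : Matrix (Fin n) (Fin n) ℤ) = 1 := by
      ext i j; simp [Matrix.one_apply]
    rw [gvol_eq_sqrt_det, h1, Matrix.mul_one, det_mul, det_transpose, Real.sqrt_mul_self_eq_abs, hg]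

end SW

namespace SW

/-! ### Orbits under positive diagonal and unimodular integer matrices -/

instance {ι κ : Type*} [Countable ι] [Countable κ] : FirstCountableTopology (Matrix ι κ ℝ) :=
  inferInstanceAs (FirstCountableTopology (ι → κ → ℝ))

lemma isCompact_entries {ι κ : Type*} (R : ℝ) :
    IsCompact {F : Matrix ι κ ℝ | ∀ i j, |F i j| ≤ R} := by
  have hc : IsCompact (Set.pi Set.univ fun _ : ι => Set.pi Set.univ fun _ : κ => Set.Icc (-R) R) :=
    isCompact_univ_pi fun _ => isCompact_univ_pi fun _ => isCompact_Icc
  refine hc.of_isClosed_subset ?_ fun F hF i _ j _ => abs_le.1 (hF i j)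
  have : {F : Matrix ι κ ℝ | ∀ i j, |F i j| ≤ R} = ⋂ i, ⋂ j, {F | |F i j| ≤ R} := by
    ext F; simp
  rw [this]
  exact isClosed_iInter fun i => isClosed_iInter fun j =>
    isClosed_le (continuous_id.matrix_elem i j).abs continuous_const

section Orbit

variable {ι κ : Type*} [Fintype ι] [DecidableEq ι] [Fintype κ] [DecidableEq κ]

/-- The double orbit of `x` under the diagonal group on the left and `GL(ℤ)` on the right. -/
def orbit (x : Matrix ι ι ℝ) : Set (Matrix ι ι ℝ) :=
  {p | ∃ (d : ι → ℝ) (γ : Matrix ι ι ℤ), (∀ i, 0 < d i) ∧ ∏ i, d i = 1 ∧ IsUnit γ.det ∧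
    p = diagonal d * x * castM γ}

/-- The closure of the orbit of `x` contains a stable point. -/
def Good (x : Matrix ι ι ℝ) : Prop := ∃ h ∈ closure (orbit x), MStable h

lemma abs_det_castM {γ : Matrix ι ι ℤ} (hγ : IsUnit γ.det) : |(castM γ).det| = 1 := by
  rw [det_castM]
  rcases Int.isUnit_iff.1 hγ with h | h <;> simp [h]

lemma abs_det_of_mem_orbit {x p : Matrix ι ι ℝ} (hp : p ∈ orbit x) : |p.det| = |x.det| := by
  obtain ⟨d, γ, -, h1, hγ, rfl⟩ := hp
  rw [det_mul, det_mul, det_diagonal, h1, one_mul, abs_mul, abs_det_castM hγ, mul_one]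

lemma abs_det_of_mem_closure_orbit {x p : Matrix ι ι ℝ} (hp : p ∈ closure (orbit x)) :
    |p.det| = |x.det| := by
  have hc : IsClosed {p : Matrix ι ι ℝ | |p.det| = |x.det|} :=
    isClosed_eq (continuous_id.matrix_det.abs) continuous_const
  exact closure_minimal (fun q hq => abs_det_of_mem_orbit hq) hc hp

lemma closure_orbit_subset {x z : Matrix ι ι ℝ} (hz : z ∈ closure (orbit x)) :
    closure (orbit z) ⊆ closure (orbit x) := by
  refine closure_minimal ?_ isClosed_closure
  rintro _ ⟨d, γ, hd, h1, hγ, rfl⟩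
  refine map_mem_closure (f := fun z => diagonal d * z * castM γ) (by fun_prop) hz ?_
  rintro _ ⟨d', γ', hd', h1', hγ', rfl⟩
  refine ⟨d * d', γ' * γ, fun i => mul_pos (hd i) (hd' i), ?_, ?_, ?_⟩
  · simp [Finset.prod_mul_distrib, h1, h1']
  · rw [det_mul]; exact hγ'.mul hγ
  · rw [castM_mul]
    have : diagonal (d * d') = diagonal d * diagonal d' := by
      rw [diagonal_mul_diagonal]; rfl
    rw [this]
    simp only [Matrix.mul_assoc]

lemma Good.of_mem_closure_orbit {x z : Matrix ι ι ℝ} (h : Good z) (hz : z ∈ closure (orbit x)) :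
    Good x := by
  obtain ⟨p, hp, hs⟩ := h
  exact ⟨p, closure_orbit_subset hz hp, hs⟩

lemma submatrix_mem_orbit {x p : Matrix ι ι ℝ} (hp : p ∈ orbit x) (σ e : κ ≃ ι) :
    p.submatrix σ e ∈ orbit (x.submatrix σ e) := by
  obtain ⟨d, γ, hd, h1, hγ, rfl⟩ := hp
  refine ⟨d ∘ σ, γ.submatrix e e, fun i => hd _, ?_, ?_, ?_⟩
  · rw [← h1]; exact σ.prod_comp d
  · rwa [det_submatrix_equiv_self]
  · rw [← submatrix_mul_equiv _ _ _ e, ← submatrix_mul_equiv _ _ _ σ, submatrix_diagonal_equiv]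
    rfl

lemma submatrix_mem_closure_orbit {x p : Matrix ι ι ℝ} (hp : p ∈ closure (orbit x)) (σ e : κ ≃ ι) :
    p.submatrix σ e ∈ closure (orbit (x.submatrix σ e)) :=
  map_mem_closure (f := fun p : Matrix ι ι ℝ => p.submatrix σ e)
    (continuous_id.matrix_submatrix _ _) hp fun _ hq => submatrix_mem_orbit hq σ e

lemma Good.submatrix {x : Matrix ι ι ℝ} (h : Good x) (σ e : κ ≃ ι) : Good (x.submatrix σ e) := by
  obtain ⟨p, hp, hs⟩ := h
  exact ⟨_, submatrix_mem_closure_orbit hp σ e, hs.submatrix σ e⟩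

/-- The upper right block of a block upper triangular matrix can be reduced modulo integers. -/
lemma exists_fromBlocks_mem_orbit {B P : Matrix ι ι ℝ} {C Q : Matrix κ κ ℝ} (hB : |B.det| = 1)
    (hP : P ∈ orbit B) (hQ : Q ∈ orbit C) (X : Matrix ι κ ℝ) :
    ∃ F : Matrix ι κ ℝ, (∀ i j, |F i j| ≤ 1) ∧
      Matrix.fromBlocks P (P * F) 0 Q ∈ orbit (Matrix.fromBlocks B X 0 C) := by
  have hPdet : P.det ≠ 0 := by
    intro h0
    have := abs_det_of_mem_orbit hP
    rw [h0, hB] at this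
    simp at this
  obtain ⟨d, β, hd, h1, hβ, hPe⟩ := hP
  obtain ⟨d', γ, hd', h1', hγ, hQe⟩ := hQ
  let W := P⁻¹ * (diagonal d * X * castM γ)
  let k : Matrix ι κ ℤ := of fun i j => -⌊W i j⌋
  refine ⟨castM k + W, fun i j => ?_, Sum.elim d d', Matrix.fromBlocks β (β * k) 0 γ, ?_, ?_, ?_,
    ?_⟩
  · have : (castM k + W) i j = Int.fract (W i j) := by
      rw [← Int.self_sub_floor, sub_eq_neg_add]; simp [k]
    rw [this, abs_of_nonneg (Int.fract_nonneg _)]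
    exact (Int.fract_lt_one _).le
  · rintro (i | i)
    · exact hd i
    · exact hd' i
  · simp [h1, h1']
  · rw [det_fromBlocks_zero₂₁]; exact hβ.mul hγ
  · have hcast : castM (Matrix.fromBlocks β (β * k) 0 γ)
        = Matrix.fromBlocks (castM β) (castM β * castM k) 0 (castM γ) := by
      rw [← castM_mul]; simp [castM, fromBlocks_map]
    have hdiag : diagonal (Sum.elim d d') = Matrix.fromBlocks (diagonal d) 0 0 (diagonal d') := by
      rw [fromBlocks_diagonal]
    rw [hcast, hdiag, fromBlocks_multiply, fromBlocks_multiply, Matrix.mul_add,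
      mul_nonsing_inv_cancel_left _ _ hPdet.isUnit, hPe, hQe]
    simp [Matrix.mul_assoc]

lemma Good.fromBlocks {B : Matrix ι ι ℝ} {C : Matrix κ κ ℝ} (hBdet : |B.det| = 1)
    (hB : Good B) (hC : Good C) (X : Matrix ι κ ℝ) : Good (Matrix.fromBlocks B X 0 C) := by
  obtain ⟨B', hB', hBs⟩ := hB
  obtain ⟨C', hC', hCs⟩ := hC
  obtain ⟨P, hP, hPlim⟩ := mem_closure_iff_seq_limit.1 hB'
  obtain ⟨Q, hQ, hQlim⟩ := mem_closure_iff_seq_limit.1 hC'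
  choose F hF hmem using fun k => exists_fromBlocks_mem_orbit hBdet (hP k) (hQ k) X
  obtain ⟨F', -, φ, hφ, hFlim⟩ := (isCompact_entries (ι := ι) (κ := κ) 1).tendsto_subseq hF
  refine ⟨Matrix.fromBlocks B' (B' * F') 0 C', ?_, hBs.fromBlocks hCs _⟩
  have hcont : Continuous fun t : Matrix ι ι ℝ × Matrix ι κ ℝ × Matrix κ κ ℝ =>
      Matrix.fromBlocks t.1 (t.1 * t.2.1) 0 t.2.2 := by
    refine Continuous.matrix_fromBlocks ?_ ?_ ?_ ?_ <;> fun_prop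
  have hlim := (hcont.tendsto (B', F', C')).comp
    ((hPlim.comp hφ.tendsto_atTop).prodMk_nhds
      (hFlim.prodMk_nhds (hQlim.comp hφ.tendsto_atTop)))
  exact mem_closure_of_tendsto hlim (Eventually.of_forall fun k => hmem (φ k))

end Orbit

end SW

namespace SW

/-! ### Reduction theory for the supremum norm -/

/-- A matrix bordered by a first row and a first column. -/
def bord {R : Type*} {n : ℕ} (a : R) (r c : Fin n → R) (M : Matrix (Fin n) (Fin n) R) :
    Matrix (Fin (n + 1)) (Fin (n + 1)) R :=
  of (Fin.cons (Fin.cons a r) fun i => Fin.cons (c i) (M i))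

section Bord

variable {R : Type*} {n : ℕ} (a : R) (r c : Fin n → R) (M : Matrix (Fin n) (Fin n) R)

@[simp] lemma bord_zero_zero : bord a r c M 0 0 = a := rfl
@[simp] lemma bord_zero_succ (j : Fin n) : bord a r c M 0 j.succ = r j := rfl
@[simp] lemma bord_succ_zero (i : Fin n) : bord a r c M i.succ 0 = c i := rfl
@[simp] lemma bord_succ_succ (i j : Fin n) : bord a r c M i.succ j.succ = M i j := rfl

end Bord

lemma det_bord_zero_col {R : Type*} [CommRing R] {n : ℕ} (a : R) (r : Fin n → R)
    (M : Matrix (Fin n) (Fin n) R) : (bord a r 0 M).det = a * M.det := by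
  rw [det_succ_column_zero, Fin.sum_univ_succ]
  have h : (bord a r 0 M).submatrix Fin.succ Fin.succ = M := by
    ext i j; simp
  simp [h]

/-- The Schur complement of the top left entry of an invertible matrix is invertible. -/
lemma det_schur_ne_zero {n : ℕ} {Y : Matrix (Fin (n + 1)) (Fin (n + 1)) ℝ} (hY : Y.det ≠ 0)
    (hb : Y 0 0 ≠ 0) :
    (of fun i j : Fin n => Y i.succ j.succ - Y i.succ 0 * Y 0 j.succ / Y 0 0).det ≠ 0 := by
  intro h0
  have h := det_eq_of_forall_row_eq_smul_add_const (A := Y)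
    (B := bord (Y 0 0) (fun j => Y 0 j.succ) 0
      (of fun i j : Fin n => Y i.succ j.succ - Y i.succ 0 * Y 0 j.succ / Y 0 0))
    (Fin.cons 0 fun i => Y i.succ 0 / Y 0 0) 0 rfl ?_
  · rw [det_bord_zero_col, h0, mul_zero] at h
    exact hY h
  · intro i j
    refine Fin.cases ?_ (fun i => ?_) i <;> refine Fin.cases ?_ (fun j => ?_) j
    · simp
    · simp
    · simp [hb]
    · simp; ring

lemma exists_pos_le_norm_mulVec {n : ℕ} {y : Matrix (Fin n) (Fin n) ℝ} (hy : y.det ≠ 0) :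
    ∃ c : ℝ, 0 < c ∧ ∀ m : Fin n → ℤ, m ≠ 0 → c ≤ ‖y *ᵥ fun i => (m i : ℝ)‖ := by
  set K := ∑ i, ∑ j, |y⁻¹ i j| with hK
  have hK0 : 0 ≤ K := Finset.sum_nonneg fun i _ => Finset.sum_nonneg fun j _ => abs_nonneg _
  refine ⟨1 / (K + 1), by positivity, fun m hm => ?_⟩
  obtain ⟨i, hi⟩ := Function.ne_iff.1 hm
  set w := y *ᵥ fun i => (m i : ℝ) with hw
  have h1 : (1 : ℝ) ≤ |(m i : ℝ)| := by
    exact_mod_cast Int.one_le_abs hi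
  have h2 : (m i : ℝ) = ∑ j, y⁻¹ i j * w j := by
    have : y⁻¹ *ᵥ w = fun i => (m i : ℝ) := by
      rw [hw, mulVec_mulVec, nonsing_inv_mul _ hy.isUnit, one_mulVec]
    exact (congrFun this i).symm
  have h3 : |(m i : ℝ)| ≤ K * ‖w‖ := by
    rw [h2]
    calc |∑ j, y⁻¹ i j * w j| ≤ ∑ j, |y⁻¹ i j| * ‖w‖ := by
          refine (Finset.abs_sum_le_sum_abs _ _).trans (Finset.sum_le_sum fun j _ => ?_)
          rw [abs_mul]
          exact mul_le_mul_of_nonneg_left (norm_le_pi_norm w j) (abs_nonneg _)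
      _ = (∑ j, |y⁻¹ i j|) * ‖w‖ := by rw [Finset.sum_mul]
      _ ≤ K * ‖w‖ := by
          refine mul_le_mul_of_nonneg_right ?_ (norm_nonneg _)
          exact Finset.single_le_sum (f := fun i => ∑ j, |y⁻¹ i j|)
            (fun i _ => Finset.sum_nonneg fun j _ => abs_nonneg _) (Finset.mem_univ i)
  rw [div_le_iff₀ (by positivity)]
  nlinarith [norm_nonneg w]

/-- A unimodular matrix whose first column is almost shortest, in the supremum norm. -/
lemma exists_almost_shortest {n : ℕ} {y : Matrix (Fin (n + 1)) (Fin (n + 1)) ℝ}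
    (hy : y.det ≠ 0) :
    ∃ γ : Matrix (Fin (n + 1)) (Fin (n + 1)) ℤ, IsUnit γ.det ∧
      ∀ γ' : Matrix (Fin (n + 1)) (Fin (n + 1)) ℤ, IsUnit γ'.det →
        ‖fun i => (y * castM γ) i 0‖ ≤ 4 / 3 * ‖fun i => (y * castM γ') i 0‖ := by
  obtain ⟨c, hc, hle⟩ := exists_pos_le_norm_mulVec hy
  set S : Set ℝ := {s | ∃ γ : Matrix (Fin (n + 1)) (Fin (n + 1)) ℤ, IsUnit γ.det ∧
    s = ‖fun i => (y * castM γ) i 0‖} with hS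
  have hlow : ∀ s ∈ S, c ≤ s := by
    rintro s ⟨γ, hγ, rfl⟩
    refine hle (fun i => γ i 0) fun h0 => hγ.ne_zero ?_
    exact det_eq_zero_of_column_eq_zero 0 fun i => congrFun h0 i
  have hne : S.Nonempty := ⟨_, 1, by simp, rfl⟩
  have hpos : c ≤ sInf S := le_csInf hne hlow
  obtain ⟨s, ⟨γ, hγ, rfl⟩, hs⟩ :=
    exists_lt_of_csInf_lt hne (show sInf S < 4 / 3 * sInf S by linarith)
  refine ⟨γ, hγ, fun γ' hγ' => hs.le.trans ?_⟩
  have : sInf S ≤ ‖fun i => (y * castM γ') i 0‖ := csInf_le ⟨c, hlow⟩ ⟨γ', hγ', rfl⟩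
  linarith

/-- A reduced decomposition `y γ = σ t L U`, up to a permutation `σ` of the rows. -/
structure IsReduction {n : ℕ} (y : Matrix (Fin n) (Fin n) ℝ) (σ : Equiv.Perm (Fin n))
    (γ : Matrix (Fin n) (Fin n) ℤ) (t : Fin n → ℝ) (L U : Matrix (Fin n) (Fin n) ℝ) : Prop where
  isUnit_det : IsUnit γ.det
  pos : ∀ i, 0 < t i
  le_of_le : ∀ i j, i ≤ j → t i ≤ 4 ^ n * t j
  lower : ∀ i j, i < j → L i j = 0
  abs_diag : ∀ i, |L i i| = 1
  abs_mul_le : ∀ i j, |L i j| * t i ≤ t j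
  upper : ∀ i j, j < i → U i j = 0
  diag : ∀ i, U i i = 1
  abs_le_one : ∀ i j, |U i j| ≤ 1
  eq : (y * castM γ).submatrix σ id = diagonal t * (L * U)

lemma exists_isReduction {n : ℕ} (y : Matrix (Fin n) (Fin n) ℝ) (hy : y.det ≠ 0) :
    ∃ σ γ t L U, IsReduction y σ γ t L U := by
  induction n with
  | zero =>
    exact ⟨1, 1, fun _ => 1, 1, 1, by simp, fun i => i.elim0, fun i => i.elim0, fun i => i.elim0,
      fun i => i.elim0, fun i => i.elim0, fun i => i.elim0, fun i => i.elim0, fun i => i.elim0,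
      by ext i; exact i.elim0⟩
  | succ n ih =>
    obtain ⟨γ₁, hγ₁, hmin⟩ := exists_almost_shortest hy
    obtain ⟨i₀, hi₀⟩ := Finite.exists_max fun i => |(y * castM γ₁) i 0|
    set Y : Matrix (Fin (n + 1)) (Fin (n + 1)) ℝ :=
      (y * castM γ₁).submatrix (Equiv.swap 0 i₀) id with hYdef
    have hY : Y.det ≠ 0 := by
      have : |Y.det| = |y.det| := by
        have h := abs_det_submatrix_equiv_equiv (Equiv.swap 0 i₀) (Equiv.refl _) (y * castM γ₁)
        rw [det_mul, abs_mul, abs_det_castM hγ₁, mul_one] at h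
        exact h
      rw [← abs_pos, this, abs_pos]
      exact hy
    have hcol : ∀ i, |Y i 0| ≤ |Y 0 0| := by
      intro i
      simpa [hYdef] using hi₀ (Equiv.swap 0 i₀ i)
    have hb : Y 0 0 ≠ 0 := by
      intro h0
      refine hY (det_eq_zero_of_column_eq_zero 0 fun i => ?_)
      have := hcol i
      rw [h0, abs_zero] at this
      exact abs_nonpos_iff.1 this
    set b := Y 0 0 with hbdef
    have hb' : 0 < |b| := abs_pos.2 hb
    obtain ⟨σ', γ', t', L', U', h'⟩ := ih _ (det_schur_ne_zero hY hb)
    set ρ : Fin n → ℝ := fun j => ∑ l, Y 0 l.succ * (γ' l j : ℝ) with hρ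
    set k : Fin n → ℤ := fun j => -round (ρ j / b) with hk
    set u : Fin n → ℝ := fun j => k j + ρ j / b with hu
    have hu2 : ∀ j, |u j| ≤ 1 / 2 := by
      intro j
      have : u j = ρ j / b - round (ρ j / b) := by simp [hu, hk]; ring
      rw [this]
      exact abs_sub_round _
    set σ : Equiv.Perm (Fin (n + 1)) := Equiv.Perm.decomposeFin.symm (i₀, σ') with hσ
    set γ : Matrix (Fin (n + 1)) (Fin (n + 1)) ℤ := γ₁ * bord 1 k 0 γ' with hγdef
    have hγ : IsUnit γ.det := by
      rw [hγdef, det_mul, det_bord_zero_col, one_mul]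
      exact hγ₁.mul h'.isUnit_det
    have hrow0 : ∀ j, (y * castM γ₁) (σ 0) j = Y 0 j := by
      intro j; simp [hσ, hYdef]
    have hrow : ∀ i j, (y * castM γ₁) (σ i.succ) j = Y (σ' i).succ j := by
      intro i j; simp [hσ, hYdef]
    have hmul : y * castM γ = (y * castM γ₁) * castM (bord 1 k 0 γ') := by
      rw [hγdef, castM_mul, Matrix.mul_assoc]
    have e00 : (y * castM γ) (σ 0) 0 = b := by
      rw [hmul, Matrix.mul_apply, Fin.sum_univ_succ]
      simp [hrow0, hbdef]
    have e0s : ∀ j, (y * castM γ) (σ 0) (Fin.succ j) = b * u j := by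
      intro j
      rw [hmul, Matrix.mul_apply, Fin.sum_univ_succ]
      simp only [hrow0, map_apply, bord_zero_succ, bord_succ_succ]
      simp only [hu]
      field_simp
      exact congrArg₂ (· + ·) (mul_comm _ _) rfl
    have es0 : ∀ i, (y * castM γ) (σ (Fin.succ i)) 0 = Y (σ' i).succ 0 := by
      intro i
      rw [hmul, Matrix.mul_apply, Fin.sum_univ_succ]
      simp [hrow]
    have ess : ∀ i j, (y * castM γ) (σ (Fin.succ i)) (Fin.succ j) =
        Y (σ' i).succ 0 * u j + t' i * (L' * U') i j := by
      intro i j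
      have h1 := congrFun (congrFun h'.eq i) j
      rw [diagonal_mul] at h1
      rw [← h1, hmul, Matrix.mul_apply, Fin.sum_univ_succ]
      simp only [hrow, map_apply, bord_zero_succ, bord_succ_succ, submatrix_apply, id,
        Matrix.mul_apply, of_apply, sub_mul, Finset.sum_sub_distrib]
      have h2 : ∑ l, Y (σ' i).succ 0 * Y 0 l.succ / b * (γ' l j : ℝ)
          = Y (σ' i).succ 0 * (ρ j / b) := by
        simp only [hρ]
        rw [Finset.sum_div, Finset.mul_sum]
        exact Finset.sum_congr rfl fun l _ => by ring
      rw [h2]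
      simp only [hu]
      ring
    have hfirst : ∀ j : Fin n, |b| ≤ 4 ^ (n + 1) * t' j := by
      intro j
      let z : Fin n := ⟨0, j.pos⟩
      have hz : |b| ≤ 4 * t' z := by
        have hswap : IsUnit (γ.submatrix id (Equiv.swap 0 z.succ)).det := by
          rw [det_permute']
          exact ((Equiv.Perm.sign _).isUnit.map (Int.castRingHom ℤ)).mul hγ
        have h1 : |b| ≤ ‖fun i => (y * castM γ₁) i 0‖ := by
          have := norm_le_pi_norm (fun i => (y * castM γ₁) i 0) (σ 0)
          simpa [hrow0] using this
        have h2 : ‖fun i => (y * castM (γ.submatrix id (Equiv.swap 0 z.succ))) i 0‖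
            ≤ |b| / 2 + t' z := by
          have hcol' : ∀ i, (y * castM (γ.submatrix id (Equiv.swap 0 z.succ))) i 0
              = (y * castM γ) i z.succ := by
            intro i; simp [Matrix.mul_apply]
          have ht := h'.pos z
          rw [pi_norm_le_iff_of_nonneg (by positivity)]
          intro i
          obtain ⟨i, rfl⟩ := σ.surjective i
          rw [hcol', Real.norm_eq_abs]
          refine Fin.cases ?_ (fun i => ?_) i
          · rw [e0s, abs_mul]
            nlinarith [hu2 z]
          · have hLU : (L' * U') i z = L' i z := by
              rw [Matrix.mul_apply, Finset.sum_eq_single z]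
              · rw [h'.diag, mul_one]
              · intro l _ hl
                rw [h'.upper l z, mul_zero]
                exact lt_of_le_of_ne (Fin.mk_le_of_le_val (Nat.zero_le _)) hl.symm
              · simp
            rw [ess, hLU]
            refine (abs_add_le _ _).trans ?_
            rw [abs_mul, abs_mul, abs_of_pos (h'.pos i)]
            have h3 := h'.abs_mul_le i z
            have h4 := mul_le_mul (hcol (σ' i).succ) (hu2 z) (abs_nonneg _) hb'.le
            linarith
        have h3 := hmin _ hswap
        linarith
      have := h'.le_of_le z j (Fin.mk_le_of_le_val (Nat.zero_le _))
      calc |b| ≤ 4 * t' z := hz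
        _ ≤ 4 * (4 ^ n * t' j) := by linarith
        _ = 4 ^ (n + 1) * t' j := by ring
    refine ⟨σ, γ, Fin.cons |b| t', bord (b / |b|) 0 (fun i => Y (σ' i).succ 0 / t' i) L',
      bord 1 u 0 U', hγ, ?_, ?_, ?_, ?_, ?_, ?_, ?_, ?_, ?_⟩
    · exact Fin.cases hb' h'.pos
    · refine Fin.cases (Fin.cases (fun _ => ?_) fun j _ => ?_) fun i => Fin.cases (fun h => ?_)
        fun j h => ?_
      · simp only [Fin.cons_zero]
        nlinarith [one_le_pow₀ (M₀ := ℝ) (a := 4) (by norm_num) (n := n + 1)]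
      · simpa using hfirst j
      · exact absurd h (by simp)
      · have h1 := h'.le_of_le i j (Fin.succ_le_succ_iff.1 h)
        have h2 := h'.pos j
        simp only [Fin.cons_succ]
        have : (4 : ℝ) ^ n * t' j ≤ 4 ^ (n + 1) * t' j := by
          rw [pow_succ]; nlinarith [pow_pos (show (0 : ℝ) < 4 by norm_num) n, mul_pos
            (pow_pos (show (0 : ℝ) < 4 by norm_num) n) h2]
        linarith
    · refine Fin.cases (Fin.cases (fun h => absurd h (lt_irrefl _)) fun j _ => rfl) fun i =>
        Fin.cases (fun h => absurd h (by simp)) fun j h => ?_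
      exact h'.lower i j (Fin.succ_lt_succ_iff.1 h)
    · refine Fin.cases ?_ h'.abs_diag
      rw [bord_zero_zero, abs_div, abs_abs, div_self hb'.ne']
    · refine Fin.cases (Fin.cases ?_ fun j => ?_) fun i => Fin.cases ?_ fun j => ?_
      · simp [abs_div, div_self hb'.ne']
      · simpa using (h'.pos j).le
      · simp only [bord_succ_zero, Fin.cons_succ, Fin.cons_zero]
        rw [abs_div, abs_of_pos (h'.pos i), div_mul_cancel₀ _ (h'.pos i).ne']
        exact hcol _
      · exact h'.abs_mul_le i j
    · refine Fin.cases (fun j h => absurd h (by simp)) fun i => Fin.cases (fun _ => rfl) fun j h => ?_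
      exact h'.upper i j (Fin.succ_lt_succ_iff.1 h)
    · exact Fin.cases rfl h'.diag
    · refine Fin.cases (Fin.cases ?_ fun j => ?_) fun i => Fin.cases ?_ fun j => ?_
      · simp
      · simpa using (hu2 j).trans (by norm_num)
      · simp
      · exact h'.abs_le_one i j
    · ext i j
      rw [diagonal_mul, Matrix.mul_apply, Fin.sum_univ_succ, submatrix_apply, id]
      refine Fin.cases ?_ (fun i => ?_) i <;> refine Fin.cases ?_ (fun j => ?_) j
      · rw [e00]; simp; field_simp
      · rw [e0s]; simp; field_simp
      · rw [es0]; have := (h'.pos i).ne'; simp; field_simp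
      · rw [ess]; have := (h'.pos i).ne'; simp [Matrix.mul_apply]; field_simp

end SW

namespace SW

/-! ### Boundedness and divergence of reduced orbits -/

section Reduction

variable {n : ℕ}

lemma abs_det_mul_of_triangular {L U : Matrix (Fin n) (Fin n) ℝ} (hL : ∀ i j, i < j → L i j = 0)
    (hLd : ∀ i, |L i i| = 1) (hU : ∀ i j, j < i → U i j = 0) (hUd : ∀ i, U i i = 1) :
    |(L * U).det| = 1 := by
  have h1 : L.det = ∏ i, L i i := det_of_isLowerTriangular L fun i j h => hL i j h
  have h2 : U.det = ∏ i, U i i := det_of_isUpperTriangular fun i j h => hU i j h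
  rw [det_mul, h1, h2, abs_mul, Finset.abs_prod]
  simp [hLd, hUd]

variable {y x L U : Matrix (Fin n) (Fin n) ℝ} {σ : Equiv.Perm (Fin n)}
  {γ : Matrix (Fin n) (Fin n) ℤ} {t d : Fin n → ℝ}

lemma IsReduction.prod_eq_one (h : IsReduction y σ γ t L U) (hy : |y.det| = 1) :
    ∏ i, t i = 1 := by
  have h1 := abs_det_submatrix_equiv_equiv σ (Equiv.refl _) (y * castM γ)
  have h2 : (y * castM γ).submatrix σ (Equiv.refl _) = diagonal t * (L * U) := h.eq
  rw [h2, det_mul, det_diagonal, abs_mul, det_mul y, abs_mul, hy, abs_det_castM h.isUnit_det,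
    abs_det_mul_of_triangular h.lower h.abs_diag h.upper h.diag,
    abs_of_pos (Finset.prod_pos fun i _ => h.pos i)] at h1
  simpa using h1

lemma IsReduction.abs_le (h : IsReduction y σ γ t L U) (i j : Fin n) : |L i j| ≤ 4 ^ n := by
  rcases lt_or_ge i j with hij | hij
  · rw [h.lower i j hij, abs_zero]; positivity
  · exact le_of_mul_le_mul_right ((h.abs_mul_le i j).trans (h.le_of_le j i hij)) (h.pos i)

lemma IsReduction.abs_mul_le_of_gap (h : IsReduction y σ γ t L U) {N : ℝ} (hN : 0 ≤ N)
    {c c' : Fin n} (hc : N * t c ≤ t c') {i j : Fin n} (hj : j ≤ c) (hi : c' ≤ i) :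
    |L i j| * N ≤ 4 ^ n * 4 ^ n := by
  refine le_of_mul_le_mul_right ?_ (h.pos i)
  calc |L i j| * N * t i = N * (|L i j| * t i) := by ring
    _ ≤ N * (4 ^ n * t c) :=
      mul_le_mul_of_nonneg_left ((h.abs_mul_le i j).trans (h.le_of_le j c hj)) hN
    _ = 4 ^ n * (N * t c) := by ring
    _ ≤ 4 ^ n * (4 ^ n * t i) :=
      mul_le_mul_of_nonneg_left (hc.trans (h.le_of_le c' i hi)) (by positivity)
    _ = 4 ^ n * 4 ^ n * t i := by ring

lemma IsReduction.abs_entry_le (h : IsReduction y σ γ t L U) {T : ℝ} (hT : ∀ i, t i ≤ T)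
    (i j : Fin n) : |(y * castM γ) i j| ≤ n * T := by
  obtain ⟨i, rfl⟩ := σ.surjective i
  have h1 := congrFun (congrFun h.eq i) j
  rw [submatrix_apply, id, diagonal_mul] at h1
  rw [h1, Matrix.mul_apply, abs_mul, abs_of_pos (h.pos i)]
  calc t i * |∑ k, L i k * U k j| ≤ t i * ∑ k, |L i k| := by
        refine mul_le_mul_of_nonneg_left ?_ (h.pos i).le
        refine (Finset.abs_sum_le_sum_abs _ _).trans (Finset.sum_le_sum fun k _ => ?_)
        rw [abs_mul]
        exact mul_le_of_le_one_right (abs_nonneg _) (h.abs_le_one k j)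
    _ = ∑ k, |L i k| * t i := by rw [Finset.mul_sum]; simp only [mul_comm]
    _ ≤ ∑ _k : Fin n, T := Finset.sum_le_sum fun k _ => (h.abs_mul_le i k).trans (hT k)
    _ = n * T := by simp

lemma IsReduction.mem_orbit (hd : ∀ i, 0 < d i) (h1 : ∏ i, d i = 1) (hx : |x.det| = 1)
    (h : IsReduction (diagonal d * x) σ γ t L U) :
    (L * U).submatrix σ.symm id ∈ orbit x := by
  have hdet : |(diagonal d * x).det| = 1 := by rw [det_mul, det_diagonal, h1, one_mul, hx]
  refine ⟨fun i => (t (σ.symm i))⁻¹ * d i, γ, fun i => mul_pos (inv_pos.2 (h.pos _)) (hd i), ?_,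
    h.isUnit_det, ?_⟩
  · rw [Finset.prod_mul_distrib, h1, mul_one, Finset.prod_inv_distrib,
      σ.symm.prod_comp t, h.prod_eq_one hdet, inv_one]
  · ext i j
    have h2 := congrFun (congrFun h.eq (σ.symm i)) j
    rw [submatrix_apply, id, diagonal_mul, Equiv.apply_symm_apply, Matrix.mul_assoc,
      diagonal_mul] at h2
    rw [Matrix.mul_assoc, diagonal_mul, mul_assoc, h2, inv_mul_cancel_left₀ (h.pos _).ne']
    rfl

lemma le_pow_mul_of_step {N : ℝ} (hN : 1 ≤ N) (ht : ∀ i, 0 < t i)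
    (hs : ∀ i j : Fin n, (j : ℕ) = i + 1 → t j ≤ N * t i) {i j : Fin n} (hij : i ≤ j) :
    t j ≤ N ^ n * t i := by
  have key : ∀ (k : ℕ) (j : Fin n), (j : ℕ) = i + k → t j ≤ N ^ k * t i := by
    intro k
    induction k with
    | zero => intro j hj; rw [show j = i from Fin.ext hj]; simp
    | succ k ih =>
      intro j hj
      have h1 := ih ⟨i + k, by omega⟩ rfl
      have h2 := hs ⟨i + k, by omega⟩ j hj
      rw [pow_succ', mul_assoc]
      exact h2.trans (mul_le_mul_of_nonneg_left h1 (by linarith))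
  refine (key (j - i) j (by have : (i : ℕ) ≤ j := hij; omega)).trans ?_
  exact mul_le_mul_of_nonneg_right (pow_le_pow_right₀ hN (by omega)) (ht i).le

lemma IsReduction.le_of_step (h : IsReduction y σ γ t L U) (hy : |y.det| = 1) {N : ℝ} (hN : 1 ≤ N)
    (hs : ∀ i j : Fin n, (j : ℕ) = i + 1 → t j ≤ N * t i) (j : Fin n) :
    t j ≤ 4 ^ n * N ^ n := by
  have hN' : 1 ≤ N ^ n := one_le_pow₀ hN
  have h4 : (1 : ℝ) ≤ 4 ^ n := one_le_pow₀ (by norm_num)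
  obtain ⟨i, hi⟩ : ∃ i, t i ≤ 1 := by
    by_contra! hlt
    have := Finset.prod_lt_prod_of_nonempty (s := Finset.univ) (f := fun _ => (1 : ℝ)) (g := t)
      (fun _ _ => one_pos) (fun i _ => hlt i) ⟨j, Finset.mem_univ j⟩
    rw [h.prod_eq_one hy] at this
    simp at this
  rcases le_total i j with hij | hij
  · have h1 := le_pow_mul_of_step hN h.pos hs hij
    have h2 : N ^ n * t i ≤ N ^ n * 1 := mul_le_mul_of_nonneg_left hi (by positivity)
    nlinarith
  · have h1 := h.le_of_le j i hij
    have h2 : (4 : ℝ) ^ n * t i ≤ 4 ^ n * 1 := mul_le_mul_of_nonneg_left hi (by positivity)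
    nlinarith

end Reduction

/-! ### Passing between determinant one and determinant minus one -/

section Sign

variable {n : ℕ}

lemma castM_mem_Gam {γ : Matrix (Fin n) (Fin n) ℤ} (h : γ.det = 1) : castM γ ∈ Gam n :=
  ⟨by rw [det_castM, h, Int.cast_one], fun i j => ⟨γ i j, rfl⟩⟩

lemma exists_castM_of_mem_Gam {g : Matrix (Fin n) (Fin n) ℝ} (hg : g ∈ Gam n) :
    ∃ γ : Matrix (Fin n) (Fin n) ℤ, γ.det = 1 ∧ castM γ = g := by
  choose m hm using hg.2
  have h : castM (of m) = g := by ext i j; exact (hm i j).symm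
  refine ⟨of m, ?_, h⟩
  have := hg.1
  rw [← h, det_castM] at this
  exact_mod_cast this

/-- An integral diagonal matrix with entries `±1` and prescribed determinant. -/
lemma exists_sign (hn : 0 < n) {u : ℤ} (hu : IsUnit u) :
    ∃ S : Matrix (Fin n) (Fin n) ℤ, S.det = u ∧ S * S = 1 ∧
      ∀ (p : Matrix (Fin n) (Fin n) ℝ) i j, |(p * castM S) i j| = |p i j| := by
  let s : Fin n → ℤ := fun i => if i = ⟨0, hn⟩ then u else 1
  have hs : ∀ i, IsUnit (s i) := fun i => by
    by_cases h : i = ⟨0, hn⟩ <;> simp [s, h, hu]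
  refine ⟨diagonal s, ?_, ?_, fun p i j => ?_⟩
  · simp [s]
  · rw [diagonal_mul_diagonal, ← diagonal_one]
    congr 1
    funext i
    exact Int.isUnit_mul_self (hs i)
  · have : castM (diagonal s) = diagonal fun i => (s i : ℝ) := by
      rw [castM, diagonal_map (by simp)]
    rw [this, mul_diagonal, abs_mul]
    rcases Int.isUnit_iff.1 (hs j) with h | h <;> simp [h]

lemma AOrbit_mul_subset_orbit {x : Matrix (Fin n) (Fin n) ℝ} {S : Matrix (Fin n) (Fin n) ℤ}
    (hS : IsUnit S.det) : AOrbit (x * castM S) ⊆ orbit x := by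
  rintro _ ⟨_, ⟨d, hd, h1, rfl⟩, g, hg, rfl⟩
  obtain ⟨γ, hγ, rfl⟩ := exists_castM_of_mem_Gam hg
  refine ⟨d, S * γ, hd, h1, by rwa [det_mul, hγ, mul_one], ?_⟩
  simp only [castM_mul, Matrix.mul_assoc]

lemma Good.of_bounded (hn : 0 < n)
    (H : ∀ y : Matrix (Fin n) (Fin n) ℝ, y.det = 1 → HasBoundedAOrbit y →
      ∃ h ∈ closure (AOrbit y), IsStable (latticeOf h))
    {x : Matrix (Fin n) (Fin n) ℝ} (hx : |x.det| = 1) {R : ℝ}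
    (hR : ∀ d : Fin n → ℝ, (∀ i, 0 < d i) → ∏ i, d i = 1 →
      ∃ γ : Matrix (Fin n) (Fin n) ℤ, IsUnit γ.det ∧
        ∀ i j, |(diagonal d * x * castM γ) i j| ≤ R) : Good x := by
  obtain ⟨u, hu, hxu⟩ : ∃ u : ℤ, IsUnit u ∧ x.det * u = 1 := by
    rcases (abs_eq zero_le_one).1 hx with h | h
    · exact ⟨1, isUnit_one, by simp [h]⟩
    · exact ⟨-1, isUnit_one.neg, by simp [h]⟩
  obtain ⟨S, hSdet, hSS, -⟩ := exists_sign hn hu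
  have hSu : IsUnit S.det := hSdet ▸ hu
  obtain ⟨h, hh, hst⟩ := H (x * castM S) (by rw [det_mul, det_castM, hSdet, hxu])
    ⟨_, isCompact_entries R, by
      rintro _ ⟨d, hd, h1, rfl⟩
      obtain ⟨γ, hγ, hle⟩ := hR d hd h1
      obtain ⟨S', hS'det, -, hS'⟩ := exists_sign hn (hSu.mul hγ)
      refine ⟨castM (S * γ * S'), castM_mem_Gam ?_, fun i j => ?_⟩
      · rw [det_mul, det_mul, hS'det]
        exact Int.isUnit_mul_self (hSu.mul hγ)
      · have : diagonal d * (x * castM S) * castM (S * γ * S')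
            = diagonal d * x * castM γ * castM S' := by
          calc _ = diagonal d * x * castM (S * S * γ * S') := by
                simp only [castM_mul, Matrix.mul_assoc]
            _ = _ := by rw [hSS, Matrix.one_mul, castM_mul]; simp only [Matrix.mul_assoc]
        rw [this, hS']
        exact hle i j⟩
  have hmem := closure_mono (AOrbit_mul_subset_orbit hSu) hh
  refine ⟨h, hmem, hst.mStable fun h0 => ?_⟩
  have := abs_det_of_mem_closure_orbit hmem
  rw [h0, hx] at this
  simp at this

lemma Good.exists_isStable (hn : 0 < n) {x : Matrix (Fin n) (Fin n) ℝ} (hx : x.det = 1)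
    (h : Good x) : ∃ h ∈ closure (AOrbit x), IsStable (latticeOf h) := by
  obtain ⟨h, hh, hst⟩ := h
  obtain ⟨S, hSdet, hSS, -⟩ := exists_sign hn (isUnit_one.neg : IsUnit (-1 : ℤ))
  have hSu : IsUnit S.det := by rw [hSdet]; exact isUnit_one.neg
  have hsub : orbit x ⊆ AOrbit x ∪ {p | p * castM S ∈ AOrbit x} := by
    rintro _ ⟨d, γ, hd, h1, hγ, rfl⟩
    rcases Int.isUnit_iff.1 hγ with hγ | hγ
    · exact Or.inl ⟨_, ⟨d, hd, h1, rfl⟩, _, castM_mem_Gam hγ, rfl⟩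
    · refine Or.inr ⟨_, ⟨d, hd, h1, rfl⟩, castM (γ * S), castM_mem_Gam ?_, ?_⟩
      · rw [det_mul, hγ, hSdet]; norm_num
      · simp only [castM_mul, Matrix.mul_assoc]
  have hdet : |h.det| = 1 := by rw [abs_det_of_mem_closure_orbit hh, hx, abs_one]
  have hh' := closure_mono hsub hh
  rw [closure_union] at hh'
  rcases hh' with hh' | hh'
  · exact ⟨h, hh', hst.isStable hdet⟩
  · refine ⟨h * castM S, map_mem_closure (f := fun p => p * castM S) (by fun_prop) hh'
      fun p hp => hp, (hst.mul_castM hSu).isStable ?_⟩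
    rw [det_mul, abs_mul, hdet, abs_det_castM hSu, one_mul]

end Sign

/-! ### Divergent orbits -/

lemma good_mul_of_block {p q : ℕ} {L U : Matrix (Fin (p + q)) (Fin (p + q)) ℝ}
    (hL : ∀ i j, i < j → L i j = 0) (hLd : ∀ i, |L i i| = 1) (hU : ∀ i j, j < i → U i j = 0)
    (hUd : ∀ i, U i i = 1)
    (hzero : ∀ (i : Fin q) (j : Fin p), L (Fin.natAdd p i) (Fin.castAdd q j) = 0)
    (hp : ∀ z : Matrix (Fin p) (Fin p) ℝ, |z.det| = 1 → Good z)
    (hq : ∀ z : Matrix (Fin q) (Fin q) ℝ, |z.det| = 1 → Good z) : Good (L * U) := by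
  let e : Fin p ⊕ Fin q ≃ Fin (p + q) := finSumFinEquiv
  have hlt : ∀ (i : Fin p) (j : Fin q), Fin.castAdd q i < Fin.natAdd p j := fun i j => by
    rw [Fin.lt_def, Fin.val_castAdd, Fin.val_natAdd]; omega
  have hL' : L.submatrix e e =
      fromBlocks (L.submatrix (Fin.castAdd q) (Fin.castAdd q)) 0 0
        (L.submatrix (Fin.natAdd p) (Fin.natAdd p)) := by
    ext i j
    rcases i with i | i <;> rcases j with j | j
    · simp [e]
    · simpa [e] using hL _ _ (hlt i j)
    · simpa [e] using hzero i j
    · simp [e]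
  have hU' : U.submatrix e e =
      fromBlocks (U.submatrix (Fin.castAdd q) (Fin.castAdd q))
        (U.submatrix (Fin.castAdd q) (Fin.natAdd p)) 0
        (U.submatrix (Fin.natAdd p) (Fin.natAdd p)) := by
    ext i j
    rcases i with i | i <;> rcases j with j | j
    · simp [e]
    · simp [e]
    · simpa [e] using hU _ _ (hlt j i)
    · simp [e]
  have hdet1 : |(L.submatrix (Fin.castAdd q) (Fin.castAdd q) *
      U.submatrix (Fin.castAdd q) (Fin.castAdd q)).det| = 1 :=
    abs_det_mul_of_triangular (fun i j h => hL _ _ h) (fun i => hLd _) (fun i j h => hU _ _ h)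
      fun i => hUd _
  have hdet2 : |(L.submatrix (Fin.natAdd p) (Fin.natAdd p) *
      U.submatrix (Fin.natAdd p) (Fin.natAdd p)).det| = 1 :=
    abs_det_mul_of_triangular (fun i j h => hL _ _ (by simpa using h)) (fun i => hLd _)
      (fun i j h => hU _ _ (by simpa using h)) fun i => hUd _
  have hgood : Good ((L * U).submatrix e e) := by
    rw [← submatrix_mul_equiv _ _ _ e, hL', hU', fromBlocks_multiply]
    simp only [Matrix.mul_zero, Matrix.zero_mul, add_zero, zero_add]
    exact (hp _ hdet1).fromBlocks hdet1 (hq _ hdet2) _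
  simpa using hgood.submatrix e.symm e.symm

lemma Good.of_unbounded {n : ℕ} {x : Matrix (Fin n) (Fin n) ℝ} (hx : |x.det| = 1)
    (ind : ∀ m < n, 0 < m → ∀ z : Matrix (Fin m) (Fin m) ℝ, |z.det| = 1 → Good z)
    (h : ∀ N : ℕ, ∃ d σ γ t L U, (∀ i, 0 < d i) ∧ ∏ i, d i = 1 ∧
      IsReduction (diagonal d * x) σ γ t L U ∧
      ∃ i j : Fin n, (j : ℕ) = i + 1 ∧ (N + 1 : ℝ) * t i < t j) : Good x := by
  choose d σ γ t L U hd h1 hred c c' hc hgap using h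
  obtain ⟨⟨σ₀, c₀, c₁⟩, hinf⟩ := Finite.exists_infinite_fiber fun N => (σ N, c N, c' N)
  obtain ⟨ψ, hψ, hfib⟩ := Filter.extraction_of_frequently_atTop
    (Nat.frequently_atTop_iff_infinite.2 (Set.infinite_coe_iff.1 hinf))
  have hfib' : ∀ k, σ (ψ k) = σ₀ ∧ c (ψ k) = c₀ ∧ c' (ψ k) = c₁ := fun k => by
    simpa using hfib k
  obtain ⟨L₀, -, φ₁, hφ₁, hL₀⟩ := (isCompact_entries (4 ^ n)).tendsto_subseq
    fun k => (hred (ψ k)).abs_le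
  obtain ⟨U₀, -, φ₂, hφ₂, hU₀⟩ := (isCompact_entries 1).tendsto_subseq
    fun k => (hred (ψ (φ₁ k))).abs_le_one
  set ω : ℕ → ℕ := fun k => ψ (φ₁ (φ₂ k)) with hω
  have hωmono : StrictMono ω := hψ.comp (hφ₁.comp hφ₂)
  have hLω : ∀ i j, Tendsto (fun k => L (ω k) i j) atTop (𝓝 (L₀ i j)) := fun i j =>
    ((continuous_id.matrix_elem i j).tendsto L₀).comp (hL₀.comp hφ₂.tendsto_atTop)
  have hUω : ∀ i j, Tendsto (fun k => U (ω k) i j) atTop (𝓝 (U₀ i j)) := fun i j =>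
    ((continuous_id.matrix_elem i j).tendsto U₀).comp hU₀
  have hmem : (L₀ * U₀).submatrix σ₀.symm id ∈ closure (orbit x) := by
    have hcont : Continuous fun s : Matrix (Fin n) (Fin n) ℝ × Matrix (Fin n) (Fin n) ℝ =>
        (s.1 * s.2).submatrix σ₀.symm id := by fun_prop
    refine mem_closure_of_tendsto ((hcont.tendsto (L₀, U₀)).comp
      ((hL₀.comp hφ₂.tendsto_atTop).prodMk_nhds hU₀)) (Eventually.of_forall fun k => ?_)
    have := (hred (ω k)).mem_orbit (hd _) (h1 _) hx
    rwa [(hfib' _).1] at this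
  refine Good.of_mem_closure_orbit (Good.submatrix ?_ σ₀.symm (Equiv.refl _)) hmem
  have hlow : ∀ i j, i < j → L₀ i j = 0 := fun i j hij =>
    tendsto_nhds_unique (hLω i j)
      (tendsto_const_nhds.congr fun k => ((hred (ω k)).lower i j hij).symm)
  have hdiag : ∀ i, |L₀ i i| = 1 := fun i =>
    tendsto_nhds_unique (hLω i i).abs
      (tendsto_const_nhds.congr fun k => ((hred (ω k)).abs_diag i).symm)
  have hup : ∀ i j, j < i → U₀ i j = 0 := fun i j hij =>
    tendsto_nhds_unique (hUω i j)
      (tendsto_const_nhds.congr fun k => ((hred (ω k)).upper i j hij).symm)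
  have hone : ∀ i, U₀ i i = 1 := fun i =>
    tendsto_nhds_unique (hUω i i)
      (tendsto_const_nhds.congr fun k => ((hred (ω k)).diag i).symm)
  have hc₀ : (c₁ : ℕ) = c₀ + 1 := by
    have := hc (ψ 0)
    rwa [(hfib' 0).2.1, (hfib' 0).2.2] at this
  have hzero : ∀ i j, j ≤ c₀ → c₁ ≤ i → L₀ i j = 0 := by
    intro i j hj hi
    refine tendsto_nhds_unique (hLω i j) (squeeze_zero_norm
      (a := fun k => 4 ^ n * 4 ^ n * (1 / ((ω k : ℝ) + 1))) (fun k => ?_) ?_)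
    · have hg := hgap (ω k)
      rw [(hfib' _).2.1, (hfib' _).2.2] at hg
      have := (hred (ω k)).abs_mul_le_of_gap (by positivity) hg.le hj hi
      rw [mul_one_div, le_div_iff₀ (by positivity)]
      exact this
    · have := (tendsto_one_div_add_atTop_nhds_zero_nat (𝕜 := ℝ)).comp hωmono.tendsto_atTop
      simpa using this.const_mul ((4 : ℝ) ^ n * 4 ^ n)
  obtain ⟨p, hp⟩ : ∃ p, p = (c₁ : ℕ) := ⟨_, rfl⟩
  obtain ⟨q, rfl⟩ : ∃ q, n = p + q := ⟨n - p, by omega⟩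
  refine good_mul_of_block hlow hdiag hup hone (fun i j => hzero _ _ ?_ ?_)
    (ind p (by omega) (by omega)) (ind q (by omega) (by omega))
  · rw [Fin.le_def, Fin.val_castAdd]; omega
  · rw [Fin.le_def, Fin.val_natAdd]; omega

lemma good_of_forall_bounded {n : ℕ}
    (H : ∀ d : ℕ, 0 < d → d ≤ n → ∀ y : Matrix (Fin d) (Fin d) ℝ, y.det = 1 →
      HasBoundedAOrbit y → ∃ h ∈ closure (AOrbit y), IsStable (latticeOf h))
    (m : ℕ) (hm : 0 < m) (hmn : m ≤ n) (x : Matrix (Fin m) (Fin m) ℝ) (hx : |x.det| = 1) :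
    Good x := by
  induction m using Nat.strong_induction_on with
  | _ m ih =>
  have hdet : ∀ d : Fin m → ℝ, ∏ i, d i = 1 → |(diagonal d * x).det| = 1 := fun d h1 => by
    rw [det_mul, det_diagonal, h1, one_mul, hx]
  by_cases hN : ∃ N : ℕ, ∀ (d : Fin m → ℝ), (∀ i, 0 < d i) → ∏ i, d i = 1 →
      ∃ σ γ t L U, IsReduction (diagonal d * x) σ γ t L U ∧
        ∀ i j : Fin m, (j : ℕ) = i + 1 → t j ≤ (N + 1 : ℝ) * t i
  · obtain ⟨N, hN⟩ := hN
    refine Good.of_bounded hm (H m hm hmn) hx (R := m * (4 ^ m * (N + 1) ^ m)) fun d hd h1 => ?_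
    obtain ⟨σ, γ, t, L, U, hred, hstep⟩ := hN d hd h1
    exact ⟨γ, hred.isUnit_det, hred.abs_entry_le (hred.le_of_step (hdet d h1) (by simp) hstep)⟩
  · refine Good.of_unbounded hx (fun k hk hk0 z hz => ih k hk hk0 (by omega) z hz) fun N => ?_
    push Not at hN
    obtain ⟨d, hd, h1, hno⟩ := hN N
    obtain ⟨σ, γ, t, L, U, hred⟩ := exists_isReduction (diagonal d * x) (by
      rw [← abs_pos, hdet d h1]; exact one_pos)
    obtain ⟨i, j, hij, hlt⟩ := hno σ γ t L U hred
    exact ⟨d, σ, γ, t, L, U, hd, h1, hred, i, j, hij, hlt⟩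

end SW

/-- **Proposition 2.4.** If, in every dimension `d ≤ n`, the orbit closure of every bounded
`A_d`-orbit contains a stable lattice, then for every `x ∈ ℒ_n` the closure of `A·x` contains
a stable lattice. -/
theorem SW.reduction_to_bounded_orbits (n : ℕ) (hn : 2 ≤ n)
    (H : ∀ d : ℕ, 0 < d → d ≤ n → ∀ y : Matrix (Fin d) (Fin d) ℝ, y.det = 1 →
      SW.HasBoundedAOrbit y →
      ∃ h ∈ closure (SW.AOrbit y), SW.IsStable (SW.latticeOf h)) :
    ∀ x : Matrix (Fin n) (Fin n) ℝ, x.det = 1 →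
      ∃ h ∈ closure (SW.AOrbit x), SW.IsStable (SW.latticeOf h) := by
  intro x hx
  exact (SW.good_of_forall_bounded H n (by omega) le_rfl x
    (by rw [hx, abs_one])).exists_isStable (by omega) hx
end
end

section
/- For any ρ > 0 there exists a neighborhood W of the identity in SL_n(ℝ) with the following property: if 2ρ ≤ δ₀ ≤ n+1 and x ∈ ℒ_n satisfies dim_{δ₀−ρ}(x) = dim_{δ₀+ρ}(x), then for every g ∈ W and every δ ∈ (δ₀ − ρ/2, δ₀ + ρ/2) one has V_δ(gx) = g·V_{δ₀}(x); in particular there is 1 ≤ k ≤ n such that dim_δ(gx) = k for all such g and δ. -/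
open scoped BigOperators
open Matrix Topology Filter

noncomputable section

namespace SW

open scoped MatrixOrder ComplexOrder in
theorem exists_transpose_mul_self {r : ℕ} {A : Matrix (Fin r) (Fin r) ℝ} (hA : A.PosDef) :
    ∃ S : Matrix (Fin r) (Fin r) ℝ, IsUnit S.det ∧ A = Sᵀ * S := by
  obtain ⟨S, hS⟩ := CStarAlgebra.nonneg_iff_eq_star_mul_self.mp hA.posSemidef.nonneg
  rw [star_eq_conjTranspose, conjTranspose_eq_transpose_of_trivial] at hS
  refine ⟨S, ?_, hS⟩
  have h := hA.det_pos
  rw [hS, det_mul, det_transpose] at h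
  exact isUnit_iff_ne_zero.mpr fun h0 => by simp [h0] at h

theorem det_le_pow_of_dotProduct_le {r : ℕ} {B : Matrix (Fin r) (Fin r) ℝ} (hB : B.PosSemidef)
    {c : ℝ} (h : ∀ x, x ⬝ᵥ (B *ᵥ x) ≤ c * (x ⬝ᵥ x)) : B.det ≤ c ^ r := by
  rw [hB.1.det_eq_prod_eigenvalues]
  calc ∏ i, ((hB.1.eigenvalues i : ℝ) : ℝ) ≤ ∏ _i : Fin r, c := by
        refine Finset.prod_le_prod (fun i _ => hB.eigenvalues_nonneg i) fun i _ => ?_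
        rw [hB.1.eigenvalues_eq i]
        have h1 : (hB.1.eigenvectorBasis i).ofLp ⬝ᵥ (hB.1.eigenvectorBasis i).ofLp = 1 := by
          have := hB.1.eigenvectorBasis.orthonormal.1 i
          have h2 := real_inner_self_eq_norm_sq (hB.1.eigenvectorBasis i)
          rw [this, EuclideanSpace.inner_eq_star_dotProduct] at h2
          simpa using h2
        simpa [h1] using h (hB.1.eigenvectorBasis i).ofLp
    _ = c ^ r := by simp

theorem det_le_pow_mul_det {r : ℕ} {A B : Matrix (Fin r) (Fin r) ℝ} (hA : A.PosDef)
    (hB : B.PosSemidef) {c : ℝ} (h : ∀ x, x ⬝ᵥ (B *ᵥ x) ≤ c * (x ⬝ᵥ (A *ᵥ x))) :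
    B.det ≤ c ^ r * A.det := by
  obtain ⟨S, hS, rfl⟩ := exists_transpose_mul_self hA
  have hSS : S * S⁻¹ = 1 := mul_nonsing_inv S hS
  have hB' : (S⁻¹ᵀ * B * S⁻¹).PosSemidef := by
    simpa using hB.conjTranspose_mul_mul_same S⁻¹
  have key : (S⁻¹ᵀ * B * S⁻¹).det ≤ c ^ r := by
    refine det_le_pow_of_dotProduct_le hB' fun x => ?_
    have hx := h (S⁻¹ *ᵥ x)
    have e1 : ∀ M : Matrix (Fin r) (Fin r) ℝ,
        (S⁻¹ *ᵥ x) ⬝ᵥ (M *ᵥ (S⁻¹ *ᵥ x)) = x ⬝ᵥ ((S⁻¹ᵀ * M * S⁻¹) *ᵥ x) := by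
      intro M
      rw [← mulVec_mulVec, ← mulVec_mulVec, dotProduct_mulVec x, vecMul_transpose]
    have e2 : S⁻¹ᵀ * (Sᵀ * S) * S⁻¹ = 1 := by
      rw [← Matrix.mul_assoc, ← transpose_mul, hSS, transpose_one, Matrix.one_mul, hSS]
    rw [e1, e1, e2, one_mulVec] at hx
    exact hx
  have hd : B.det = (S⁻¹ᵀ * B * S⁻¹).det * (Sᵀ * S).det := by
    have : S.det * S⁻¹.det = 1 := by rw [← det_mul, hSS, det_one]
    simp only [det_mul, det_transpose]
    linear_combination (-B.det * (S.det * S⁻¹.det + 1)) * this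
  rw [hd]
  exact mul_le_mul_of_nonneg_right key hA.det_pos.le

theorem gram_eq_mul_transpose {n r : ℕ} (v : Fin r → (Fin n → ℝ)) :
    (Matrix.of fun i j => einner (v i) (v j)) = Matrix.of v * (Matrix.of v)ᵀ := by
  ext i j
  simp [Matrix.mul_apply, einner]

theorem gram_posSemidef {n r : ℕ} (v : Fin r → (Fin n → ℝ)) :
    (Matrix.of fun i j => einner (v i) (v j)).PosSemidef := by
  rw [gram_eq_mul_transpose, ← conjTranspose_eq_transpose_of_trivial]
  exact posSemidef_self_mul_conjTranspose _

theorem gram_posDef {n r : ℕ} {v : Fin r → (Fin n → ℝ)} (hv : LinearIndependent ℝ v) :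
    (Matrix.of fun i j => einner (v i) (v j)).PosDef := by
  rw [gram_eq_mul_transpose, ← conjTranspose_eq_transpose_of_trivial]
  exact PosDef.mul_conjTranspose_self _ (vecMul_injective_iff.mpr hv)

theorem dotProduct_gram_mulVec {n r : ℕ} (v : Fin r → (Fin n → ℝ)) (x : Fin r → ℝ) :
    x ⬝ᵥ ((Matrix.of fun i j => einner (v i) (v j)) *ᵥ x) =
      einner (∑ i, x i • v i) (∑ i, x i • v i) := by
  have h : ∑ i, x i • v i = x ᵥ* Matrix.of v := by
    rw [vecMul_eq_sum]; rfl
  rw [gram_eq_mul_transpose, ← mulVec_mulVec, dotProduct_mulVec, h, mulVec_transpose]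
  rfl

/-- `T` is Lipschitz with constant `K` for the Euclidean norms. -/
def EuclLipschitz {m n : ℕ} (K : ℝ) (T : (Fin m → ℝ) →ₗ[ℝ] (Fin n → ℝ)) : Prop :=
  ∀ x, einner (T x) (T x) ≤ K ^ 2 * einner x x

theorem gvol_nonneg {n r : ℕ} (v : Fin r → (Fin n → ℝ)) : 0 ≤ gvol v := Real.sqrt_nonneg _

theorem gvol_comp_le {m n r : ℕ} {K : ℝ} (hK : 0 ≤ K) {T : (Fin m → ℝ) →ₗ[ℝ] (Fin n → ℝ)}
    (hT : EuclLipschitz K T) {v : Fin r → (Fin m → ℝ)} (hv : LinearIndependent ℝ v) :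
    gvol (T ∘ v) ≤ K ^ r * gvol v := by
  unfold gvol
  rw [← Real.sqrt_sq (pow_nonneg hK r), ← Real.sqrt_mul (sq_nonneg _), pow_right_comm]
  refine Real.sqrt_le_sqrt (det_le_pow_mul_det (gram_posDef hv) (gram_posSemidef (T ∘ v)) ?_)
  intro x
  rw [dotProduct_gram_mulVec, dotProduct_gram_mulVec]
  simpa using hT (∑ i, x i • v i)

open scoped Matrix.Norms.L2Operator in
theorem euclLipschitz_of_norm_le {m n : ℕ} {A : Matrix (Fin n) (Fin m) ℝ} {K : ℝ} (h : ‖A‖ ≤ K) :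
    EuclLipschitz K (Matrix.mulVecLin A) := by
  intro x
  have h1 := l2_opNorm_mulVec A (WithLp.toLp 2 x)
  have e : ∀ {k : ℕ} (y : Fin k → ℝ),
      einner y y = ‖(WithLp.toLp 2 y : EuclideanSpace ℝ (Fin k))‖ ^ 2 := by
    intro k y
    rw [EuclideanSpace.real_norm_sq_eq]
    simp [einner, sq]
  rw [e, e, ← mul_pow]
  exact pow_le_pow_left₀ (norm_nonneg _)
    (h1.trans (mul_le_mul_of_nonneg_right h (norm_nonneg _))) 2

theorem exists_euclLipschitz {m n : ℕ} (T : (Fin m → ℝ) →ₗ[ℝ] (Fin n → ℝ)) :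
    ∃ K : ℝ, 1 ≤ K ∧ EuclLipschitz K T := by
  obtain ⟨K, hK⟩ : ∃ K : ℝ, 1 ≤ K ∧
      EuclLipschitz K (Matrix.mulVecLin (LinearMap.toMatrix' T)) := by
    open scoped Matrix.Norms.L2Operator in
    exact ⟨max 1 ‖LinearMap.toMatrix' T‖, le_max_left _ _,
      euclLipschitz_of_norm_le (le_max_right _ _)⟩
  rw [← Matrix.toLin'_apply', Matrix.toLin'_toMatrix'] at hK
  exact ⟨K, hK⟩

open scoped Matrix.Norms.L2Operator in
theorem eventually_euclLipschitz {n : ℕ} (hn : 0 < n) {K : ℝ} (hK : 1 < K) :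
    ∀ᶠ g in 𝓝 (1 : Matrix (Fin n) (Fin n) ℝ),
      EuclLipschitz K (Matrix.mulVecLin g) ∧ EuclLipschitz K (Matrix.mulVecLin g⁻¹) := by
  have : NeZero n := ⟨hn.ne'⟩
  have h1 : ‖(1 : Matrix (Fin n) (Fin n) ℝ)‖ < K := by simpa using hK
  have h2 : ContinuousAt (fun g : Matrix (Fin n) (Fin n) ℝ => g⁻¹) 1 := by
    apply continuousAt_matrix_inv
    rw [det_one]
    exact NormedRing.inverse_continuousAt (1 : ℝˣ)
  filter_upwards [continuous_norm.continuousAt.eventually_lt_const h1,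
    h2.norm.eventually_lt_const (by simpa using hK)] with g hg hg'
  exact ⟨euclLipschitz_of_norm_le hg.le, euclLipschitz_of_norm_le hg'.le⟩

theorem covolSpec_nonneg {n : ℕ} {Λ : AddSubgroup (Fin n → ℝ)} {c : ℝ} (h : covolSpec Λ c) :
    0 ≤ c := by
  obtain ⟨r, v, -, -, rfl⟩ := h
  exact gvol_nonneg v

theorem covol_nonneg {n : ℕ} (Λ : AddSubgroup (Fin n → ℝ)) : 0 ≤ covol Λ :=
  Real.sInf_nonneg fun _ => covolSpec_nonneg

theorem span_closure_range {n r : ℕ} (v : Fin r → (Fin n → ℝ)) :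
    Submodule.span ℝ (AddSubgroup.closure (Set.range v) : Set (Fin n → ℝ)) =
      Submodule.span ℝ (Set.range v) := by
  refine le_antisymm (Submodule.span_le.mpr ?_) (Submodule.span_mono AddSubgroup.subset_closure)
  exact (AddSubgroup.closure_le (K := (Submodule.span ℝ (Set.range v)).toAddSubgroup)).mpr
    Submodule.subset_span

theorem rk_closure_range {n r : ℕ} {v : Fin r → (Fin n → ℝ)} (hv : LinearIndependent ℝ v) :
    rk (AddSubgroup.closure (Set.range v)) = r := by
  rw [rk, span_closure_range, finrank_span_eq_card hv, Fintype.card_fin]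

/-- The image of a subgroup under a linear automorphism. -/
def mapEquiv {n : ℕ} (e : (Fin n → ℝ) ≃ₗ[ℝ] (Fin n → ℝ)) (Λ : AddSubgroup (Fin n → ℝ)) :
    AddSubgroup (Fin n → ℝ) :=
  Λ.map (e : (Fin n → ℝ) →ₗ[ℝ] (Fin n → ℝ)).toAddMonoidHom

section mapEquiv

variable {n : ℕ} (e : (Fin n → ℝ) ≃ₗ[ℝ] (Fin n → ℝ)) (Λ : AddSubgroup (Fin n → ℝ))

theorem coe_mapEquiv : (mapEquiv e Λ : Set (Fin n → ℝ)) = e '' Λ := rfl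

theorem mapEquiv_symm_mapEquiv : mapEquiv e.symm (mapEquiv e Λ) = Λ := by
  apply SetLike.coe_injective
  simp [coe_mapEquiv, Set.image_image]

theorem mapEquiv_mono {Λ Λ' : AddSubgroup (Fin n → ℝ)} (h : Λ ≤ Λ') :
    mapEquiv e Λ ≤ mapEquiv e Λ' :=
  AddSubgroup.map_mono h

variable {Λ} in
theorem mapEquiv_ne_bot (h : Λ ≠ ⊥) : mapEquiv e Λ ≠ ⊥ := by
  intro h0
  apply h
  rw [← mapEquiv_symm_mapEquiv e Λ, h0]
  exact AddSubgroup.map_bot _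

theorem span_mapEquiv : Submodule.span ℝ (mapEquiv e Λ : Set (Fin n → ℝ)) =
    (Submodule.span ℝ (Λ : Set (Fin n → ℝ))).map (e : (Fin n → ℝ) →ₗ[ℝ] (Fin n → ℝ)) := by
  rw [Submodule.map_span]
  rfl

theorem rk_mapEquiv : rk (mapEquiv e Λ) = rk Λ := by
  rw [rk, span_mapEquiv, LinearEquiv.finrank_map_eq, rk]

theorem mapEquiv_closure_range {r : ℕ} (v : Fin r → (Fin n → ℝ)) :
    mapEquiv e (AddSubgroup.closure (Set.range v)) =
      AddSubgroup.closure (Set.range ((e : (Fin n → ℝ) →ₗ[ℝ] (Fin n → ℝ)) ∘ v)) := by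
  rw [mapEquiv, AddMonoidHom.map_closure, Set.range_comp]
  rfl

variable {Λ} in
theorem exists_covolSpec_mapEquiv_le {K : ℝ} (hK : 0 ≤ K)
    (he : EuclLipschitz K (e : (Fin n → ℝ) →ₗ[ℝ] (Fin n → ℝ))) {c : ℝ} (hc : covolSpec Λ c) :
    ∃ c', covolSpec (mapEquiv e Λ) c' ∧ c' ≤ K ^ rk Λ * c := by
  obtain ⟨r, v, hv, rfl, rfl⟩ := hc
  refine ⟨_, ⟨r, _, ?_, mapEquiv_closure_range e v, rfl⟩, ?_⟩
  · exact hv.map' _ e.ker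
  · rw [rk_closure_range hv]
    exact gvol_comp_le hK he hv

theorem covol_mapEquiv_le {K : ℝ} (hK : 1 ≤ K)
    (he : EuclLipschitz K (e : (Fin n → ℝ) →ₗ[ℝ] (Fin n → ℝ))) :
    covol (mapEquiv e Λ) ≤ K ^ rk Λ * covol Λ := by
  have hK0 : 0 < K := by linarith
  by_cases hne : {c | covolSpec Λ c}.Nonempty
  · rw [← div_le_iff₀' (by positivity)]
    refine le_csInf hne fun c hc => ?_
    obtain ⟨c', hc', hle⟩ := exists_covolSpec_mapEquiv_le e hK0.le he hc
    rw [div_le_iff₀' (by positivity)]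
    exact (csInf_le ⟨0, fun _ => covolSpec_nonneg⟩ hc').trans hle
  · have h0 : {c | covolSpec (mapEquiv e Λ) c} = ∅ := by
      rw [Set.eq_empty_iff_forall_notMem]
      intro c hc
      obtain ⟨K', hK', he'⟩ := exists_euclLipschitz (e.symm : (Fin n → ℝ) →ₗ[ℝ] (Fin n → ℝ))
      obtain ⟨c', hc', -⟩ := exists_covolSpec_mapEquiv_le e.symm (by linarith) he' hc
      rw [mapEquiv_symm_mapEquiv] at hc'
      exact hne ⟨c', hc'⟩
    rw [covol, h0, Real.sInf_empty]
    exact mul_nonneg (by positivity) (covol_nonneg Λ)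

theorem covol_rpow_mapEquiv_le {K : ℝ} (hK : 1 ≤ K)
    (he : EuclLipschitz K (e : (Fin n → ℝ) →ₗ[ℝ] (Fin n → ℝ))) :
    covol (mapEquiv e Λ) ^ ((rk (mapEquiv e Λ) : ℝ)⁻¹) ≤ K * covol Λ ^ ((rk Λ : ℝ)⁻¹) := by
  rw [rk_mapEquiv]
  rcases eq_or_ne (rk Λ) 0 with h0 | h0
  · simpa [h0] using hK
  · calc covol (mapEquiv e Λ) ^ ((rk Λ : ℝ)⁻¹) ≤ (K ^ rk Λ * covol Λ) ^ ((rk Λ : ℝ)⁻¹) :=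
          Real.rpow_le_rpow (covol_nonneg _) (covol_mapEquiv_le e Λ hK he) (by positivity)
      _ = K * covol Λ ^ ((rk Λ : ℝ)⁻¹) := by
          rw [Real.mul_rpow (by positivity) (covol_nonneg _),
            Real.pow_rpow_inv_natCast (by linarith) h0]

end mapEquiv

theorem alpha_nonneg {n : ℕ} (L : AddSubgroup (Fin n → ℝ)) : 0 ≤ alpha L := by
  refine Real.sInf_nonneg ?_
  rintro c ⟨Λ, -, -, rfl⟩
  exact Real.rpow_nonneg (covol_nonneg Λ) _

theorem alpha_le {n : ℕ} {L Λ : AddSubgroup (Fin n → ℝ)} (h : Λ ≤ L) (h0 : Λ ≠ ⊥) :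
    alpha L ≤ covol Λ ^ ((rk Λ : ℝ)⁻¹) := by
  refine csInf_le ⟨0, ?_⟩ ⟨Λ, h, h0, rfl⟩
  rintro c ⟨Λ', -, -, rfl⟩
  exact Real.rpow_nonneg (covol_nonneg Λ') _

theorem le_alpha {n : ℕ} {L : AddSubgroup (Fin n → ℝ)} (hL : L ≠ ⊥) {a : ℝ}
    (h : ∀ Λ ≤ L, Λ ≠ ⊥ → a ≤ covol Λ ^ ((rk Λ : ℝ)⁻¹)) : a ≤ alpha L := by
  refine le_csInf ⟨_, L, le_rfl, hL, rfl⟩ ?_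
  rintro c ⟨Λ, h1, h2, rfl⟩
  exact h Λ h1 h2

theorem alpha_mapEquiv_le {n : ℕ} (e : (Fin n → ℝ) ≃ₗ[ℝ] (Fin n → ℝ)) {K : ℝ} (hK : 1 ≤ K)
    (he : EuclLipschitz K (e : (Fin n → ℝ) →ₗ[ℝ] (Fin n → ℝ))) {L : AddSubgroup (Fin n → ℝ)}
    (hL : L ≠ ⊥) : alpha (mapEquiv e L) ≤ K * alpha L := by
  have hK0 : 0 < K := by linarith
  rw [← div_le_iff₀' hK0]
  refine le_alpha hL fun Λ h h0 => ?_
  rw [div_le_iff₀' hK0]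
  exact (alpha_le (mapEquiv_mono e h) (mapEquiv_ne_bot e h0)).trans
    (covol_rpow_mapEquiv_le e Λ hK he)

theorem mapEquiv_mem_MinSet {n : ℕ} (e : (Fin n → ℝ) ≃ₗ[ℝ] (Fin n → ℝ)) {K : ℝ} (hK : 1 ≤ K)
    (he : EuclLipschitz K (e : (Fin n → ℝ) →ₗ[ℝ] (Fin n → ℝ)))
    (he' : EuclLipschitz K (e.symm : (Fin n → ℝ) →ₗ[ℝ] (Fin n → ℝ)))
    {L : AddSubgroup (Fin n → ℝ)} (hL : L ≠ ⊥) {δ δ' : ℝ} (hδ : 0 ≤ δ)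
    (hδδ' : K ^ 2 * (1 + δ) ≤ 1 + δ') {Λ : AddSubgroup (Fin n → ℝ)} (h : Λ ∈ MinSet δ L) :
    mapEquiv e Λ ∈ MinSet δ' (mapEquiv e L) := by
  obtain ⟨h1, h2, h3⟩ := h
  have hK0 : 0 < K := by linarith
  refine ⟨mapEquiv_mono e h1, mapEquiv_ne_bot e h2, ?_⟩
  have hα : alpha L ≤ K * alpha (mapEquiv e L) := by
    simpa only [mapEquiv_symm_mapEquiv] using
      alpha_mapEquiv_le e.symm hK he' (mapEquiv_ne_bot e hL)
  calc _ ≤ K * covol Λ ^ ((rk Λ : ℝ)⁻¹) := covol_rpow_mapEquiv_le e Λ hK he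
    _ < K * ((1 + δ) * alpha L) := by gcongr
    _ ≤ K * ((1 + δ) * (K * alpha (mapEquiv e L))) := by gcongr
    _ = K ^ 2 * (1 + δ) * alpha (mapEquiv e L) := by ring
    _ ≤ (1 + δ') * alpha (mapEquiv e L) :=
        mul_le_mul_of_nonneg_right hδδ' (alpha_nonneg _)

theorem map_Vdelta_le {n : ℕ} (e : (Fin n → ℝ) ≃ₗ[ℝ] (Fin n → ℝ)) {K : ℝ} (hK : 1 ≤ K)
    (he : EuclLipschitz K (e : (Fin n → ℝ) →ₗ[ℝ] (Fin n → ℝ)))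
    (he' : EuclLipschitz K (e.symm : (Fin n → ℝ) →ₗ[ℝ] (Fin n → ℝ)))
    {L : AddSubgroup (Fin n → ℝ)} (hL : L ≠ ⊥) {δ δ' : ℝ} (hδ : 0 ≤ δ)
    (hδδ' : K ^ 2 * (1 + δ) ≤ 1 + δ') :
    (Vdelta δ L).map (e : (Fin n → ℝ) →ₗ[ℝ] (Fin n → ℝ)) ≤ Vdelta δ' (mapEquiv e L) := by
  rw [Vdelta, Submodule.map_span_le]
  intro x hx
  obtain ⟨Λ, hΛ, hxΛ⟩ := Set.mem_iUnion₂.mp hx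
  exact Submodule.subset_span (Set.mem_iUnion₂.mpr
    ⟨_, mapEquiv_mem_MinSet e hK he he' hL hδ hδδ' hΛ, Set.mem_image_of_mem e hxΛ⟩)

theorem Vdelta_mono {n : ℕ} (L : AddSubgroup (Fin n → ℝ)) {δ δ' : ℝ} (h : δ ≤ δ') :
    Vdelta δ L ≤ Vdelta δ' L := by
  refine Submodule.span_mono (Set.biUnion_subset_biUnion_left ?_)
  rintro Λ ⟨h1, h2, h3⟩
  refine ⟨h1, h2, h3.trans_le (mul_le_mul_of_nonneg_right (by linarith) (alpha_nonneg L))⟩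

theorem one_le_gvol_intCast {m r : ℕ} (u : Fin m → Fin r → ℤ)
    (hu : LinearIndependent ℝ fun j i => (u j i : ℝ)) : 1 ≤ gvol fun j i => (u j i : ℝ) := by
  have hpos := (gram_posDef hu).det_pos
  have h : (Matrix.of fun j k => einner (fun i => (u j i : ℝ)) fun i => (u k i : ℝ)) =
      (Matrix.of fun j k => ∑ i, u j i * u k i).map (Int.castRingHom ℝ) := by
    ext j k
    simp [einner]
  rw [gvol, Real.one_le_sqrt]
  rw [h, ← RingHom.mapMatrix_apply, ← RingHom.map_det] at hpos ⊢
  simp only [eq_intCast] at hpos ⊢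
  exact_mod_cast Int.cast_pos.mp hpos

theorem mem_closure_range_iff_exists_intCast {n r : ℕ} {v : Fin r → (Fin n → ℝ)}
    {x : Fin n → ℝ} : x ∈ AddSubgroup.closure (Set.range v) ↔
      ∃ u : Fin r → ℤ, Fintype.linearCombination ℝ v (fun i => (u i : ℝ)) = x := by
  rw [← Submodule.span_int_eq_addSubgroupClosure, Submodule.mem_toAddSubgroup,
    Submodule.mem_span_range_iff_exists_fun]
  simp [Fintype.linearCombination_apply, Int.cast_smul_eq_zsmul]

theorem exists_one_le_pow_mul_gvol {n r : ℕ} {v : Fin r → (Fin n → ℝ)}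
    (hv : LinearIndependent ℝ v) :
    ∃ K : ℝ, 1 ≤ K ∧ ∀ (m : ℕ) (w : Fin m → (Fin n → ℝ)), LinearIndependent ℝ w →
      (∀ j, w j ∈ AddSubgroup.closure (Set.range v)) → 1 ≤ K ^ m * gvol w := by
  obtain ⟨h, hh⟩ := (Fintype.linearCombination ℝ v).exists_leftInverse_of_injective
    (LinearMap.ker_eq_bot.mpr hv.fintypeLinearCombination_injective)
  obtain ⟨K, hK, hLip⟩ := exists_euclLipschitz h
  refine ⟨K, hK, fun m w hw hmem => ?_⟩
  choose u hu using fun j => mem_closure_range_iff_exists_intCast.mp (hmem j)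
  have hcomp : h ∘ w = fun j i => (u j i : ℝ) := by
    funext j
    rw [Function.comp_apply, ← hu j]
    exact LinearMap.congr_fun hh _
  have hind : LinearIndependent ℝ fun j i => (u j i : ℝ) := by
    refine LinearIndependent.of_comp (Fintype.linearCombination ℝ v) ?_
    convert hw using 1
    funext j
    exact hu j
  calc 1 ≤ gvol (h ∘ w) := by rw [hcomp]; exact one_le_gvol_intCast u hind
    _ ≤ K ^ m * gvol w := gvol_comp_le (by linarith) hLip hw

theorem exists_covolSpec_of_le {n r : ℕ} {v : Fin r → (Fin n → ℝ)}
    (hv : LinearIndependent ℝ v) {Λ : AddSubgroup (Fin n → ℝ)}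
    (hΛ : Λ ≤ AddSubgroup.closure (Set.range v)) : ∃ c, covolSpec Λ c := by
  let φ : (Fin r → ℤ) →ₗ[ℤ] (Fin n → ℝ) := Fintype.linearCombination ℤ v
  have hφ : ∀ u : Fin r → ℤ, φ u = Fintype.linearCombination ℝ v (fun i => (u i : ℝ)) := by
    intro u
    simp [φ, Fintype.linearCombination_apply, Int.cast_smul_eq_zsmul]
  let N : Submodule ℤ (Fin r → ℤ) := (AddSubgroup.toIntSubmodule Λ).comap φ
  obtain ⟨m, b⟩ := Submodule.basisOfPid (Pi.basisFun ℤ (Fin r)) N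
  have hb : LinearIndependent ℝ fun j i => ((b j : Fin r → ℤ) i : ℝ) :=
    (linearIndependent_algebraMap_comp_iff (R := ℤ) (S := ℝ)).mpr
      (b.linearIndependent.map' N.subtype N.ker_subtype)
  refine ⟨_, m, fun j => φ (b j), ?_, ?_, rfl⟩
  · simp only [hφ]
    exact hb.map' (Fintype.linearCombination ℝ v)
      (LinearMap.ker_eq_bot.mpr hv.fintypeLinearCombination_injective)
  · have hspan : Submodule.span ℤ (Set.range fun j => φ (b j)) = AddSubgroup.toIntSubmodule Λ := by
      have h1 : (Set.range fun j => φ (b j)) = φ '' (N.subtype '' Set.range b) := by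
        rw [← Set.range_comp, ← Set.range_comp]
        rfl
      rw [h1, ← Submodule.map_span, ← Submodule.map_span, b.span_eq, Submodule.map_top,
        Submodule.range_subtype, Submodule.map_comap_eq, inf_eq_right]
      intro x hx
      obtain ⟨u, hu⟩ := mem_closure_range_iff_exists_intCast.mp (hΛ hx)
      exact ⟨u, (hφ u).trans hu⟩
    rw [← Submodule.span_int_eq_addSubgroupClosure, hspan]
    rfl

theorem rk_ne_zero {n : ℕ} {Λ : AddSubgroup (Fin n → ℝ)} (h : Λ ≠ ⊥) : rk Λ ≠ 0 := by
  intro h0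
  rw [rk, Submodule.finrank_eq_zero, Submodule.span_eq_bot] at h0
  exact h ((AddSubgroup.eq_bot_iff_forall _).mpr h0)

theorem alpha_pos {n r : ℕ} {v : Fin r → (Fin n → ℝ)} (hv : LinearIndependent ℝ v)
    (hL : AddSubgroup.closure (Set.range v) ≠ ⊥) :
    0 < alpha (AddSubgroup.closure (Set.range v)) := by
  obtain ⟨K, hK, hgvol⟩ := exists_one_le_pow_mul_gvol hv
  have hK0 : 0 < K := by linarith
  refine (inv_pos.mpr hK0).trans_le (le_alpha hL fun Λ hΛ h0 => ?_)
  have hcov : K⁻¹ ^ rk Λ ≤ covol Λ := by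
    refine le_csInf (exists_covolSpec_of_le hv hΛ) ?_
    rintro c ⟨m, w, hw, rfl, rfl⟩
    rw [rk_closure_range hw, inv_pow, inv_le_iff_one_le_mul₀' (by positivity)]
    exact hgvol m w hw fun j => hΛ (AddSubgroup.subset_closure ⟨j, rfl⟩)
  calc K⁻¹ = (K⁻¹ ^ rk Λ) ^ ((rk Λ : ℝ)⁻¹) :=
        (Real.pow_rpow_inv_natCast (by positivity) (rk_ne_zero h0)).symm
    _ ≤ _ := Real.rpow_le_rpow (by positivity) hcov (by positivity)

theorem Vdelta_ne_bot {n : ℕ} {L : AddSubgroup (Fin n → ℝ)} (hL : L ≠ ⊥) (hα : 0 < alpha L)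
    {δ : ℝ} (hδ : 0 < δ) : Vdelta δ L ≠ ⊥ := by
  have hlt : alpha L < (1 + δ) * alpha L := by nlinarith
  obtain ⟨c, ⟨Λ, hΛ, h0, rfl⟩, hc⟩ := exists_lt_of_csInf_lt (by exact ⟨_, L, le_rfl, hL, rfl⟩) hlt
  rw [Vdelta, Ne, Submodule.span_eq_bot]
  intro h
  exact h0 ((AddSubgroup.eq_bot_iff_forall _).mpr fun x hx =>
    h x (Set.mem_iUnion₂.mpr ⟨Λ, ⟨hΛ, h0, hc⟩, hx⟩))

theorem IsLattice.ne_bot {n : ℕ} (hn : 0 < n) {L : AddSubgroup (Fin n → ℝ)} (hL : IsLattice L) :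
    L ≠ ⊥ := by
  rintro rfl
  have : NeZero n := ⟨hn.ne'⟩
  have h := hL.2
  rw [AddSubgroup.coe_bot, Submodule.span_zero_singleton] at h
  exact bot_ne_top h

theorem IsUnimodularLattice.alpha_pos {n : ℕ} (hn : 0 < n) {L : AddSubgroup (Fin n → ℝ)}
    (hL : IsUnimodularLattice L) : 0 < alpha L := by
  have hne : {c | covolSpec L c}.Nonempty := by
    by_contra h
    have h1 := hL.2
    rw [covol, Set.not_nonempty_iff_eq_empty.mp h, Real.sInf_empty] at h1
    exact zero_ne_one h1
  obtain ⟨_, r, v, hv, rfl, -⟩ := hne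
  exact SW.alpha_pos hv (hL.1.ne_bot hn)

theorem Vdelta_mapEquiv_eq {n : ℕ} (e : (Fin n → ℝ) ≃ₗ[ℝ] (Fin n → ℝ)) {K : ℝ} (hK : 1 ≤ K)
    (he : EuclLipschitz K (e : (Fin n → ℝ) →ₗ[ℝ] (Fin n → ℝ)))
    (he' : EuclLipschitz K (e.symm : (Fin n → ℝ) →ₗ[ℝ] (Fin n → ℝ)))
    {L : AddSubgroup (Fin n → ℝ)} (hL : L ≠ ⊥) {δ₁ δ₂ δ δ₀ : ℝ} (hδ₁ : 0 ≤ δ₁) (hδ : 0 ≤ δ)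
    (h₁ : K ^ 2 * (1 + δ₁) ≤ 1 + δ) (h₂ : K ^ 2 * (1 + δ) ≤ 1 + δ₂)
    (h₁₀ : δ₁ ≤ δ₀) (h₀₂ : δ₀ ≤ δ₂) (hdim : dimdelta δ₁ L = dimdelta δ₂ L) :
    Vdelta δ (mapEquiv e L) = (Vdelta δ₀ L).map (e : (Fin n → ℝ) →ₗ[ℝ] (Fin n → ℝ)) := by
  have h12 : Vdelta δ₁ L = Vdelta δ₂ L :=
    Submodule.eq_of_le_of_finrank_eq (Vdelta_mono L (h₁₀.trans h₀₂)) hdim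
  apply le_antisymm
  · have h := map_Vdelta_le e.symm hK he' he (mapEquiv_ne_bot e hL) hδ h₂
    rw [mapEquiv_symm_mapEquiv, ← h12] at h
    intro x hx
    exact ⟨e.symm x, Vdelta_mono L h₁₀ (h (Submodule.mem_map_of_mem hx)), e.apply_symm_apply x⟩
  · refine (Submodule.map_mono (Vdelta_mono L h₀₂)).trans ?_
    rw [← h12]
    exact map_Vdelta_le e hK he he' hL hδ₁ h₁

theorem exists_linearEquiv_of_isUnit_det {n : ℕ} {g : Matrix (Fin n) (Fin n) ℝ}
    (hg : IsUnit g.det) : ∃ e : (Fin n → ℝ) ≃ₗ[ℝ] (Fin n → ℝ),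
      (e : (Fin n → ℝ) →ₗ[ℝ] (Fin n → ℝ)) = Matrix.mulVecLin g ∧
      (e.symm : (Fin n → ℝ) →ₗ[ℝ] (Fin n → ℝ)) = Matrix.mulVecLin g⁻¹ :=
  ⟨LinearEquiv.ofLinearMap (Matrix.mulVecLin g) (Matrix.mulVecLin g⁻¹)
    (by rw [← Matrix.mulVecLin_mul, mul_nonsing_inv g hg, Matrix.mulVecLin_one])
    (by rw [← Matrix.mulVecLin_mul, nonsing_inv_mul g hg, Matrix.mulVecLin_one]), rfl, rfl⟩

theorem exists_one_lt_sq_mul_le {M ε : ℝ} (hM : 0 < M) (hε : 0 < ε) :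
    ∃ K : ℝ, 1 < K ∧ ∀ t, t ≤ M → K ^ 2 * t ≤ t + ε := by
  have h : 0 < ε / M := by positivity
  refine ⟨√(1 + ε / M), Real.lt_sqrt_of_sq_lt (by linarith), fun t ht => ?_⟩
  rw [Real.sq_sqrt (by positivity)]
  have : ε / M * t ≤ ε / M * M := by gcongr
  rw [div_mul_cancel₀ _ hM.ne'] at this
  linarith

end SW

/-- **Lemma 2.6.** For any `ρ > 0` there is a neighborhood `W` of the identity in `SL_n(ℝ)`
such that if `2ρ ≤ δ₀ ≤ n+1` and `dim_{δ₀-ρ}(x) = dim_{δ₀+ρ}(x)`, then for all `g ∈ W` and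
`δ ∈ (δ₀ - ρ/2, δ₀ + ρ/2)` one has `V_δ(gx) = g V_{δ₀}(x)`; in particular there is
`1 ≤ k ≤ n` with `dim_δ(gx) = k` for all such `g, δ`. -/
theorem SW.Vdelta_stability (n : ℕ) (hn : 0 < n) (ρ : ℝ) (hρ : 0 < ρ) :
    ∃ W ∈ 𝓝 (1 : Matrix (Fin n) (Fin n) ℝ),
      ∀ δ₀ : ℝ, 2 * ρ ≤ δ₀ → δ₀ ≤ (n : ℝ) + 1 →
      ∀ L : AddSubgroup (Fin n → ℝ), SW.IsUnimodularLattice L →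
      SW.dimdelta (δ₀ - ρ) L = SW.dimdelta (δ₀ + ρ) L →
      (∀ g ∈ W, g.det = 1 → ∀ δ ∈ Set.Ioo (δ₀ - ρ / 2) (δ₀ + ρ / 2),
        SW.Vdelta δ (SW.mapLat g L) = Submodule.map (Matrix.mulVecLin g) (SW.Vdelta δ₀ L)) ∧
      ∃ k : ℕ, 1 ≤ k ∧ k ≤ n ∧
        ∀ g ∈ W, g.det = 1 → ∀ δ ∈ Set.Ioo (δ₀ - ρ / 2) (δ₀ + ρ / 2),
          SW.dimdelta δ (SW.mapLat g L) = k := by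
  obtain ⟨K, hK, hKt⟩ := SW.exists_one_lt_sq_mul_le (M := n + 2 + ρ / 2) (ε := ρ / 2)
    (by positivity) (by positivity)
  refine ⟨_, SW.eventually_euclLipschitz hn hK, fun δ₀ hδ₀ hδ₀n L hL hdim => ?_⟩
  have hL0 : L ≠ ⊥ := hL.1.ne_bot hn
  have hV : ∀ g : Matrix (Fin n) (Fin n) ℝ, SW.EuclLipschitz K (Matrix.mulVecLin g) ∧
      SW.EuclLipschitz K (Matrix.mulVecLin g⁻¹) → g.det = 1 →
      ∀ δ ∈ Set.Ioo (δ₀ - ρ / 2) (δ₀ + ρ / 2),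
        SW.Vdelta δ (SW.mapLat g L) =
          Submodule.map (Matrix.mulVecLin g) (SW.Vdelta δ₀ L) ∧
        SW.dimdelta δ (SW.mapLat g L) = SW.dimdelta δ₀ L := by
    rintro g ⟨hg, hg'⟩ hdet δ ⟨hδ1, hδ2⟩
    obtain ⟨e, he, he'⟩ := SW.exists_linearEquiv_of_isUnit_det (g := g) (by simp [hdet])
    rw [← he] at hg
    rw [← he'] at hg'
    have hmap : SW.mapLat g L = SW.mapEquiv e L := by rw [SW.mapLat, SW.mapEquiv, he]
    have h₁ := hKt (1 + (δ₀ - ρ)) (by linarith)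
    have h₂ := hKt (1 + δ) (by linarith)
    have key := SW.Vdelta_mapEquiv_eq e hK.le hg hg' hL0 (δ₁ := δ₀ - ρ) (δ₂ := δ₀ + ρ) (δ := δ)
      (δ₀ := δ₀) (by linarith) (by linarith) (by linarith) (by linarith) (by linarith)
      (by linarith) hdim
    rw [SW.dimdelta, hmap, key, LinearEquiv.finrank_map_eq, he]
    exact ⟨rfl, rfl⟩
  refine ⟨fun g hg hdet δ hδ => (hV g hg hdet δ hδ).1, SW.dimdelta δ₀ L, ?_, ?_,
    fun g hg hdet δ hδ => (hV g hg hdet δ hδ).2⟩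
  · rw [SW.dimdelta, Submodule.one_le_finrank_iff]
    exact SW.Vdelta_ne_bot hL0 (hL.alpha_pos hn) (by linarith)
  · simpa [SW.dimdelta] using Submodule.finrank_le (SW.Vdelta δ₀ L)
end
end
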